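/- arXiv:2212.06549 — 12 statements merged into one kernel-verified Lean document; each statement's English description precedes it below -/
import Mathlib

section
/- Let f : I → ℝ be smooth with f > 0 on an open interval I ⊆ (−π/2, π/2) containing 0, and let E(y¹,y²) = ((y¹)² + (y²)²)·f(arctan(y²/y¹)) on the cone C_I = {(y¹,y²) : y¹ > 0, arctan(y²/y¹) ∈ I}. Then the fundamental form g_y (the Hessian bilinear form of E at y) is positive definite for every y ∈ C_I if and only if D(t) = 2f(t)f''(t) − f'(t)² + 4f(t)² > 0 for every t ∈ I. -/
open Real Set

/-- The Hessian bilinear form (fundamental form) of the energy function `E` at `y`,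
evaluated on the pair `(u, v)`. -/
noncomputable def hessian (E : ℝ × ℝ → ℝ) (y u v : ℝ × ℝ) : ℝ :=
  fderiv ℝ (fderiv ℝ E) y u v

/-- The energy function `E(y¹,y²) = ((y¹)² + (y²)²)·f(arctan(y²/y¹))`. -/
noncomputable def energy (f : ℝ → ℝ) (y : ℝ × ℝ) : ℝ :=
  (y.1 ^ 2 + y.2 ^ 2) * f (Real.arctan (y.2 / y.1))

/-- The open cone `C_I = {(y¹,y²) : y¹ > 0, arctan(y²/y¹) ∈ I}`. -/
def cone (I : Set ℝ) : Set (ℝ × ℝ) :=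
  {y : ℝ × ℝ | 0 < y.1 ∧ Real.arctan (y.2 / y.1) ∈ I}

/-- `D(t) = 2f(t)f''(t) − f'(t)² + 4f(t)²`. -/
noncomputable def Dfun (f : ℝ → ℝ) (t : ℝ) : ℝ :=
  2 * f t * deriv (deriv f) t - (deriv f t) ^ 2 + 4 * (f t) ^ 2

/-- The differential of the angle function. -/
theorem angle_hasFDerivAt (y : ℝ × ℝ) (hy : 0 < y.1) :
    HasFDerivAt (fun z : ℝ × ℝ => Real.arctan (z.2 / z.1))
      ((-y.2 / (y.1 ^ 2 + y.2 ^ 2)) • ContinuousLinearMap.fst ℝ ℝ ℝ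
        + (y.1 / (y.1 ^ 2 + y.2 ^ 2)) • ContinuousLinearMap.snd ℝ ℝ ℝ) y := by
  have h1 : HasFDerivAt (fun z : ℝ × ℝ => z.1) (ContinuousLinearMap.fst ℝ ℝ ℝ) y :=
    hasFDerivAt_fst
  have h2 : HasFDerivAt (fun z : ℝ × ℝ => z.2) (ContinuousLinearMap.snd ℝ ℝ ℝ) y :=
    hasFDerivAt_snd
  have h3 := (hasDerivAt_inv hy.ne').comp_hasFDerivAt y h1
  have h4 := (h2.mul h3).arctan
  have hR : y.1 ^ 2 + y.2 ^ 2 ≠ 0 := by positivity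
  have hy' := hy.ne'
  refine (h4.congr_fderiv ?_).congr_of_eventuallyEq ?_
  · ext <;> simp <;> field_simp
  · exact Filter.Eventually.of_forall fun z => by simp [div_eq_mul_inv]

theorem energy_hasFDerivAt (f : ℝ → ℝ) (y : ℝ × ℝ) (hy : 0 < y.1) (a b : ℝ)
    (ha : f (Real.arctan (y.2 / y.1)) = a)
    (hb : HasDerivAt f b (Real.arctan (y.2 / y.1))) :
    HasFDerivAt (energy f)
      ((2 * a * y.1 - b * y.2) • ContinuousLinearMap.fst ℝ ℝ ℝ
        + (2 * a * y.2 + b * y.1) • ContinuousLinearMap.snd ℝ ℝ ℝ) y := by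
  have h1 : HasFDerivAt (fun z : ℝ × ℝ => z.1) (ContinuousLinearMap.fst ℝ ℝ ℝ) y :=
    hasFDerivAt_fst
  have h2 : HasFDerivAt (fun z : ℝ × ℝ => z.2) (ContinuousLinearMap.snd ℝ ℝ ℝ) y :=
    hasFDerivAt_snd
  have h3 := hb.comp_hasFDerivAt y (angle_hasFDerivAt y hy)
  have h4 := ((h1.pow 2).add (h2.pow 2)).mul h3
  have hR : y.1 ^ 2 + y.2 ^ 2 ≠ 0 := by positivity
  refine HasFDerivAt.congr_fderiv (f := energy f) h4 ?_
  ext <;> simp [ha] <;> field_simp <;> ring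

theorem hessian_energy (I : Set ℝ) (hI : IsOpen I) (f : ℝ → ℝ)
    (hf : ContDiffOn ℝ (⊤ : ℕ∞) f I) (y : ℝ × ℝ) (hy : y ∈ cone I) (u : ℝ × ℝ) :
    hessian (energy f) y u u =
      (2 * f (Real.arctan (y.2 / y.1)) * (y.1 * u.1 + y.2 * u.2) ^ 2
        + 2 * deriv f (Real.arctan (y.2 / y.1)) * (y.1 * u.1 + y.2 * u.2)
            * (y.1 * u.2 - y.2 * u.1)
        + (deriv (deriv f) (Real.arctan (y.2 / y.1)) + 2 * f (Real.arctan (y.2 / y.1)))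
            * (y.1 * u.2 - y.2 * u.1) ^ 2) / (y.1 ^ 2 + y.2 ^ 2) := by
  have hd : ∀ t ∈ I, HasDerivAt f (deriv f t) t := fun t ht =>
    ((hf.differentiableOn (by simp)).differentiableAt (hI.mem_nhds ht)).hasDerivAt
  have hf1 : ContDiffOn ℝ 1 (deriv f) I :=
    hf.deriv_of_isOpen hI (by norm_cast)
  have hdd : ∀ t ∈ I, HasDerivAt (deriv f) (deriv (deriv f) t) t := fun t ht =>
    ((hf1.differentiableOn (by simp)).differentiableAt (hI.mem_nhds ht)).hasDerivAt
  obtain ⟨hy1, hyI⟩ := hy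
  have hang := angle_hasFDerivAt y hy1
  have hev : fderiv ℝ (energy f) =ᶠ[nhds y] fun z =>
      ((2 * f (Real.arctan (z.2 / z.1)) * z.1 - deriv f (Real.arctan (z.2 / z.1)) * z.2) •
          ContinuousLinearMap.fst ℝ ℝ ℝ
        + (2 * f (Real.arctan (z.2 / z.1)) * z.2 + deriv f (Real.arctan (z.2 / z.1)) * z.1) •
          ContinuousLinearMap.snd ℝ ℝ ℝ) := by
    have e1 : ∀ᶠ z : ℝ × ℝ in nhds y, 0 < z.1 :=
      continuous_fst.continuousAt.eventually (lt_mem_nhds hy1)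
    have e2 : ∀ᶠ z : ℝ × ℝ in nhds y, Real.arctan (z.2 / z.1) ∈ I :=
      hang.continuousAt.eventually (hI.mem_nhds hyI)
    filter_upwards [e1, e2] with z hz1 hz2
    exact (energy_hasFDerivAt f z hz1 _ _ rfl (hd _ hz2)).fderiv
  have h1 : HasFDerivAt (fun z : ℝ × ℝ => z.1) (ContinuousLinearMap.fst ℝ ℝ ℝ) y :=
    hasFDerivAt_fst
  have h2 : HasFDerivAt (fun z : ℝ × ℝ => z.2) (ContinuousLinearMap.snd ℝ ℝ ℝ) y :=
    hasFDerivAt_snd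
  have k1 : HasFDerivAt (fun z : ℝ × ℝ => f (Real.arctan (z.2 / z.1))) _ y :=
    (hd _ hyI).comp_hasFDerivAt y hang
  have k2 : HasFDerivAt (fun z : ℝ × ℝ => deriv f (Real.arctan (z.2 / z.1))) _ y :=
    HasDerivAt.comp_hasFDerivAt (h₂ := deriv f) y (hdd _ hyI) hang
  have hP := (((k1.const_mul 2).mul h1).sub (k2.mul h2)).smul_const
    (ContinuousLinearMap.fst ℝ ℝ ℝ)
  have hQ := (((k1.const_mul 2).mul h2).add (k2.mul h1)).smul_const
    (ContinuousLinearMap.snd ℝ ℝ ℝ)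
  have hA := (hP.add hQ).congr_of_eventuallyEq hev
  have hR : y.1 ^ 2 + y.2 ^ 2 ≠ 0 := by positivity
  unfold hessian
  rw [hA.fderiv]
  simp
  field_simp
  ring

theorem strong_convexity_iff
    (I : Set ℝ) (hIopen : IsOpen I) (hIsub : I ⊆ Ioo (-(π / 2)) (π / 2))
    (hI0 : (0 : ℝ) ∈ I)
    (f : ℝ → ℝ) (hf : ContDiffOn ℝ (⊤ : ℕ∞) f I) (hfpos : ∀ t ∈ I, 0 < f t) :
    (∀ y ∈ cone I, ∀ u : ℝ × ℝ, u ≠ 0 → 0 < hessian (energy f) y u u) ↔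
      (∀ t ∈ I, 0 < Dfun f t) := by
  constructor
  · intro h t ht
    have hat : Real.arctan (Real.tan t / 1) = t := by
      rw [div_one]
      exact Real.arctan_tan (hIsub ht).1 (hIsub ht).2
    have hy : ((1 : ℝ), Real.tan t) ∈ cone I := by
      refine ⟨one_pos, ?_⟩
      show Real.arctan (Real.tan t / 1) ∈ I
      rwa [hat]
    have hft := hfpos t ht
    have hu : ((-deriv f t - Real.tan t * (2 * f t),
        2 * f t - Real.tan t * deriv f t) : ℝ × ℝ) ≠ 0 := by
      intro h0
      have e1 := congrArg Prod.fst h0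
      have e2 := congrArg Prod.snd h0
      simp only [Prod.fst_zero, Prod.snd_zero] at e1 e2
      have : 2 * f t * (1 + Real.tan t ^ 2) = 0 := by
        linear_combination e2 - Real.tan t * e1
      have : 0 < 2 * f t * (1 + Real.tan t ^ 2) := by positivity
      linarith
    have key := h _ hy _ hu
    rw [hessian_energy I hIopen f hf _ hy] at key
    simp only [hat] at key
    have hR : 0 < 1 ^ 2 + Real.tan t ^ 2 := by positivity
    have key2 := (div_pos_iff_of_pos_right hR).1 key
    have : 0 < (2 * f t * (1 + Real.tan t ^ 2) ^ 2) * Dfun f t := by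
      refine key2.trans_eq ?_
      unfold Dfun
      ring
    exact (mul_pos_iff_of_pos_left (by positivity)).1 this
  · intro h y hy u hu
    rw [hessian_energy I hIopen f hf y hy]
    have hy1 : 0 < y.1 := hy.1
    have hft := hfpos _ hy.2
    have hD := h _ hy.2
    unfold Dfun at hD
    refine div_pos ?_ (by positivity)
    set t := Real.arctan (y.2 / y.1)
    set a := y.1 * u.1 + y.2 * u.2 with ha
    set b := y.1 * u.2 - y.2 * u.1 with hb
    have id : 2 * f t * (2 * f t * a ^ 2 + 2 * deriv f t * a * b
        + (deriv (deriv f) t + 2 * f t) * b ^ 2)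
        = (2 * f t * a + deriv f t * b) ^ 2
          + (2 * f t * deriv (deriv f) t - (deriv f t) ^ 2 + 4 * (f t) ^ 2) * b ^ 2 := by
      ring
    refine (mul_pos_iff_of_pos_left (show 0 < 2 * f t by positivity)).1 ?_
    rw [id]
    by_cases hb0 : b = 0
    · have ha0 : a ≠ 0 := by
        intro ha0
        apply hu
        have hR : y.1 ^ 2 + y.2 ^ 2 ≠ 0 := by positivity
        ext
        · have : (y.1 ^ 2 + y.2 ^ 2) * u.1 = 0 := by
            linear_combination y.1 * (ha0 - ha) - y.2 * (hb0 - hb)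
          simpa [hR] using this
        · have : (y.1 ^ 2 + y.2 ^ 2) * u.2 = 0 := by
            linear_combination y.2 * (ha0 - ha) + y.1 * (hb0 - hb)
          simpa [hR] using this
      rw [hb0]
      simp only [mul_zero, add_zero, ne_eq, OfNat.ofNat_ne_zero, not_false_eq_true, zero_pow]
      positivity
    · have : 0 < b ^ 2 := by positivity
      have := mul_pos hD this
      positivity
end

section
/- Let f, C_I, E, g_y, D be as in the standard setup. For y = (y¹,y²) ∈ C_I with t = arctan(y²/y¹), set V_y = (−y² − y¹·f'(t)/(2f(t)), y¹ − y²·f'(t)/(2f(t))). Then g_y(V_y, V_y) = (((y¹)² + (y²)²)/(2f(t)))·D(t), where D(t) = 2f(t)f''(t) − f'(t)² + 4f(t)². -/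
open Real Set

open ContinuousLinearMap in
theorem hasFDerivAt_angle (z : ℝ × ℝ) (hz : 0 < z.1) :
    HasFDerivAt (fun z : ℝ × ℝ => Real.arctan (z.2 / z.1))
      ((-z.2 / (z.1 ^ 2 + z.2 ^ 2)) • fst ℝ ℝ ℝ + (z.1 / (z.1 ^ 2 + z.2 ^ 2)) • snd ℝ ℝ ℝ) z := by
  have h1 : HasFDerivAt (fun z : ℝ × ℝ => z.1) (fst ℝ ℝ ℝ) z := hasFDerivAt_fst
  have h2 : HasFDerivAt (fun z : ℝ × ℝ => z.2) (snd ℝ ℝ ℝ) z := hasFDerivAt_snd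
  have h3 := (h2.mul ((hasDerivAt_inv hz.ne').comp_hasFDerivAt z h1)).arctan
  have hr : z.1 ^ 2 + z.2 ^ 2 ≠ 0 := by positivity
  have hr' : 1 + (z.2 * z.1⁻¹) ^ 2 ≠ 0 := by positivity
  have hz' := hz.ne'
  refine (h3.congr_fderiv ?_).congr_of_eventuallyEq ?_
  · ext <;> simp <;> field_simp
  · exact Filter.Eventually.of_forall fun w => by simp [div_eq_mul_inv]

theorem cone_isOpen (I : Set ℝ) (hI : IsOpen I) (y : ℝ × ℝ) (hy : y ∈ cone I) :
    ∀ᶠ z in nhds y, z ∈ cone I := by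
  have h1 : ∀ᶠ z : ℝ × ℝ in nhds y, 0 < z.1 :=
    continuous_fst.continuousAt.eventually (lt_mem_nhds hy.1)
  have h2 := (hasFDerivAt_angle y hy.1).continuousAt.eventually (hI.mem_nhds hy.2)
  filter_upwards [h1, h2] with z a b using ⟨a, b⟩

open ContinuousLinearMap in
theorem hasFDerivAt_energy (f : ℝ → ℝ) (z : ℝ × ℝ) (hz : 0 < z.1)
    (hf : DifferentiableAt ℝ f (Real.arctan (z.2 / z.1))) :
    HasFDerivAt (energy f)
      ((2 * z.1 * f (Real.arctan (z.2 / z.1)) - z.2 * deriv f (Real.arctan (z.2 / z.1)))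
          • fst ℝ ℝ ℝ +
        (2 * z.2 * f (Real.arctan (z.2 / z.1)) + z.1 * deriv f (Real.arctan (z.2 / z.1)))
          • snd ℝ ℝ ℝ) z := by
  have h1 : HasFDerivAt (fun z : ℝ × ℝ => z.1) (fst ℝ ℝ ℝ) z := hasFDerivAt_fst
  have h2 : HasFDerivAt (fun z : ℝ × ℝ => z.2) (snd ℝ ℝ ℝ) z := hasFDerivAt_snd
  have h3 := ((h1.pow 2).add (h2.pow 2)).mul
    (hf.hasDerivAt.comp_hasFDerivAt z (hasFDerivAt_angle z hz))
  have hr : z.1 ^ 2 + z.2 ^ 2 ≠ 0 := by positivity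
  refine HasFDerivAt.congr_fderiv (f := energy f) h3 ?_
  ext <;> simp <;> field_simp <;> ring

theorem fundamental_tensor_angular
    (I : Set ℝ) (hIopen : IsOpen I) (hIsub : I ⊆ Ioo (-(π / 2)) (π / 2))
    (hI0 : (0 : ℝ) ∈ I)
    (f : ℝ → ℝ) (hf : ContDiffOn ℝ (⊤ : ℕ∞) f I) (hfpos : ∀ t ∈ I, 0 < f t)
    (y : ℝ × ℝ) (hy : y ∈ cone I) :
    hessian (energy f) y
        (-y.2 - y.1 * deriv f (Real.arctan (y.2 / y.1)) / (2 * f (Real.arctan (y.2 / y.1))),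
         y.1 - y.2 * deriv f (Real.arctan (y.2 / y.1)) / (2 * f (Real.arctan (y.2 / y.1))))
        (-y.2 - y.1 * deriv f (Real.arctan (y.2 / y.1)) / (2 * f (Real.arctan (y.2 / y.1))),
         y.1 - y.2 * deriv f (Real.arctan (y.2 / y.1)) / (2 * f (Real.arctan (y.2 / y.1)))) =
      (y.1 ^ 2 + y.2 ^ 2) / (2 * f (Real.arctan (y.2 / y.1))) *
        Dfun f (Real.arctan (y.2 / y.1)) := by
  obtain ⟨h0, ht⟩ := id hy
  have hd : ∀ t ∈ I, DifferentiableAt ℝ f t := fun t h =>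
    (hf.differentiableOn (by simp)).differentiableAt (hIopen.mem_nhds h)
  have hd2 : DifferentiableAt ℝ (deriv f) (Real.arctan (y.2 / y.1)) := by
    have h := hf.deriv_of_isOpen (m := 1) hIopen (by norm_cast)
    exact (h.differentiableOn (by simp)).differentiableAt (hIopen.mem_nhds ht)
  have hE : fderiv ℝ (energy f) =ᶠ[nhds y] fun z =>
      ((2 * z.1 * f (Real.arctan (z.2 / z.1)) - z.2 * deriv f (Real.arctan (z.2 / z.1)))
          • ContinuousLinearMap.fst ℝ ℝ ℝ +
        (2 * z.2 * f (Real.arctan (z.2 / z.1)) + z.1 * deriv f (Real.arctan (z.2 / z.1)))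
          • ContinuousLinearMap.snd ℝ ℝ ℝ) := by
    filter_upwards [cone_isOpen I hIopen y hy] with z hz
    exact (hasFDerivAt_energy f z hz.1 (hd _ hz.2)).fderiv
  have h1 : HasFDerivAt (fun z : ℝ × ℝ => z.1) (ContinuousLinearMap.fst ℝ ℝ ℝ) y :=
    hasFDerivAt_fst
  have h2 : HasFDerivAt (fun z : ℝ × ℝ => z.2) (ContinuousLinearMap.snd ℝ ℝ ℝ) y :=
    hasFDerivAt_snd
  have hT := hasFDerivAt_angle y h0
  have hF := (hd _ ht).hasDerivAt.comp_hasFDerivAt y hT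
  have hF' := hd2.hasDerivAt.comp_hasFDerivAt y hT
  have hA := ((((h1.const_mul 2).mul hF).sub (h2.mul hF')).smul_const
      (ContinuousLinearMap.fst ℝ ℝ ℝ)).add
    ((((h2.const_mul 2).mul hF).add (h1.mul hF')).smul_const (ContinuousLinearMap.snd ℝ ℝ ℝ))
  have hG := (hA.congr_of_eventuallyEq hE).fderiv
  have hp := hfpos _ ht
  have hr : y.1 ^ 2 + y.2 ^ 2 ≠ 0 := by positivity
  unfold hessian Dfun
  rw [hG]
  simp only [Function.comp_apply, ContinuousLinearMap.add_apply, ContinuousLinearMap.sub_apply,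
    ContinuousLinearMap.smul_apply, ContinuousLinearMap.smulRight_apply,
    ContinuousLinearMap.coe_fst', ContinuousLinearMap.coe_snd', smul_eq_mul]
  generalize Real.arctan (y.2 / y.1) = t at *
  generalize deriv (deriv f) t = c at *
  generalize deriv f t = b at *
  generalize f t = a at *
  have ha := hp.ne'
  field_simp
  ring
end

section
/- Let f, C_I, E be as in the standard setup. For t ∈ I define the indicatrix curve y(t) = (2f(t))^{−1/2}·(cos t, sin t) and the vector u(t) = (2f(t))^{−1/2}·(−sin t, cos t). Then for every t ∈ I, (1/2)·(d³/ds³)|_{s=0} E(y(t) + s·u(t)) = f'(t)/f(t) + f'''(t)/(4f(t)). -/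
open Real Set

theorem cartan_tensor_along_indicatrix
    (I : Set ℝ) (hIopen : IsOpen I) (hIsub : I ⊆ Ioo (-(π / 2)) (π / 2))
    (hI0 : (0 : ℝ) ∈ I)
    (f : ℝ → ℝ) (hf : ContDiffOn ℝ (⊤ : ℕ∞) f I) (hfpos : ∀ t ∈ I, 0 < f t)
    (t : ℝ) (ht : t ∈ I) :
    (1 / 2) * iteratedDeriv 3
        (fun s : ℝ =>
          energy f
            ((1 / Real.sqrt (2 * f t)) • ((Real.cos t, Real.sin t) : ℝ × ℝ) +
              s • ((1 / Real.sqrt (2 * f t)) • ((-Real.sin t, Real.cos t) : ℝ × ℝ)))) 0 =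
      deriv f t / f t + iteratedDeriv 3 f t / (4 * f t) := by
  have hI : ∀ x ∈ I, I ∈ nhds x := fun x hx => hIopen.mem_nhds hx
  have hft := hfpos t ht
  have hc0 : ContDiffOn ℝ (⊤ : ℕ∞) (deriv f) I :=
    hf.deriv_of_isOpen hIopen (by simp)
  have hc1 : ContDiffOn ℝ (⊤ : ℕ∞) (deriv (deriv f)) I :=
    hc0.deriv_of_isOpen hIopen (by simp)
  have d0 : ∀ x ∈ I, HasDerivAt f (deriv f x) x := fun x hx =>
    ((hf.differentiableOn (by simp)).differentiableAt (hI x hx)).hasDerivAt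
  have d1 : ∀ x ∈ I, HasDerivAt (deriv f) (deriv (deriv f) x) x := fun x hx =>
    ((hc0.differentiableOn (by simp)).differentiableAt (hI x hx)).hasDerivAt
  have d2 : ∀ x ∈ I, HasDerivAt (deriv (deriv f)) (deriv (deriv (deriv f)) x) x := fun x hx =>
    ((hc1.differentiableOn (by simp)).differentiableAt (hI x hx)).hasDerivAt
  have hev : ∀ᶠ s : ℝ in nhds 0, t + Real.arctan s ∈ I := by
    have hcont : ContinuousAt (fun s : ℝ => t + Real.arctan s) 0 := by fun_prop
    exact hcont.eventually_mem (by simpa using hI t ht)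
  have ha : ∀ s : ℝ, HasDerivAt (fun s : ℝ => t + Real.arctan s) (1 / (1 + s ^ 2)) s := fun s =>
    (Real.hasDerivAt_arctan s).const_add t
  have e0 : (fun s : ℝ => energy f
            ((1 / Real.sqrt (2 * f t)) • ((Real.cos t, Real.sin t) : ℝ × ℝ) +
              s • ((1 / Real.sqrt (2 * f t)) • ((-Real.sin t, Real.cos t) : ℝ × ℝ))))
      =ᶠ[nhds 0] fun s => (1 / (2 * f t)) * ((1 + s ^ 2) * f (t + Real.arctan s)) := by
    filter_upwards [hev] with s hs
    have hb := hIsub hs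
    have hr : Real.sqrt (2 * f t) ≠ 0 := by positivity
    have hr2 : Real.sqrt (2 * f t) ^ 2 = 2 * f t := Real.sq_sqrt (by positivity)
    have hca : 0 < Real.cos (Real.arctan s) := Real.cos_arctan_pos s
    have hcb : 0 < Real.cos (t + Real.arctan s) := Real.cos_pos_of_mem_Ioo hb
    have hsa : Real.sin (Real.arctan s) = s * Real.cos (Real.arctan s) := by
      have h := Real.tan_mul_cos hca.ne'
      rw [Real.tan_arctan] at h
      exact h.symm
    have hcb' : Real.cos (t + Real.arctan s)
        = (Real.cos t - s * Real.sin t) * Real.cos (Real.arctan s) := by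
      rw [Real.cos_add, hsa]; ring
    have hsb' : Real.sin (t + Real.arctan s)
        = (Real.sin t + s * Real.cos t) * Real.cos (Real.arctan s) := by
      rw [Real.sin_add, hsa]; ring
    have hd : Real.cos t - s * Real.sin t ≠ 0 := by
      intro h; rw [hcb', h] at hcb; simp at hcb
    have hq : (1 / Real.sqrt (2 * f t) * Real.sin t + s * (1 / Real.sqrt (2 * f t) * Real.cos t)) /
        (1 / Real.sqrt (2 * f t) * Real.cos t + s * (1 / Real.sqrt (2 * f t) * -Real.sin t))
        = Real.tan (t + Real.arctan s) := by
      rw [Real.tan_eq_sin_div_cos, hcb', hsb', mul_div_mul_right _ _ hca.ne',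
        ← mul_div_mul_left (Real.sin t + s * Real.cos t) _ (one_div_ne_zero hr)]
      congr 1 <;> ring
    simp only [energy, Prod.fst_add, Prod.snd_add, Prod.smul_fst, Prod.smul_snd, smul_eq_mul]
    rw [hq, Real.arctan_tan hb.1 hb.2]
    have h1 := Real.sin_sq_add_cos_sq t
    have hk : 1 / (2 * f t) = (1 / Real.sqrt (2 * f t)) ^ 2 := by
      rw [div_pow, hr2, one_pow]
    rw [hk]
    linear_combination (1 / Real.sqrt (2 * f t)) ^ 2 * (1 + s ^ 2) * f (t + Real.arctan s) * h1
  have e1 : deriv (fun s => (1 / (2 * f t)) * ((1 + s ^ 2) * f (t + Real.arctan s))) =ᶠ[nhds 0]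
      fun s => (1 / (2 * f t)) * (2 * s * f (t + Real.arctan s) + deriv f (t + Real.arctan s)) := by
    filter_upwards [hev] with s hs
    have hp : HasDerivAt (fun s : ℝ => 1 + s ^ 2) (2 * s) s := by
      simpa using (hasDerivAt_pow 2 s).const_add 1
    have h := (hp.mul ((d0 _ hs).comp s (ha s))).const_mul (1 / (2 * f t))
    refine h.deriv.trans ?_
    have : 1 + s ^ 2 ≠ 0 := by positivity
    simp only [Function.comp]
    field_simp
  have e2 : deriv (fun s => (1 / (2 * f t)) *
        (2 * s * f (t + Real.arctan s) + deriv f (t + Real.arctan s))) =ᶠ[nhds 0]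
      fun s => (1 / (2 * f t)) * (2 * f (t + Real.arctan s) +
        (2 * s * deriv f (t + Real.arctan s) + deriv (deriv f) (t + Real.arctan s))
          * (1 / (1 + s ^ 2))) := by
    filter_upwards [hev] with s hs
    have hp : HasDerivAt (fun s : ℝ => 2 * s) 2 s := by
      simpa using (hasDerivAt_id s).const_mul 2
    have h := ((hp.mul ((d0 _ hs).comp s (ha s))).add
      ((d1 _ hs).comp s (ha s))).const_mul (1 / (2 * f t))
    refine h.deriv.trans ?_
    simp only [Function.comp]
    ring
  have e3 : HasDerivAt (fun s => (1 / (2 * f t)) * (2 * f (t + Real.arctan s) +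
        (2 * s * deriv f (t + Real.arctan s) + deriv (deriv f) (t + Real.arctan s))
          * (1 / (1 + s ^ 2))))
      ((1 / (2 * f t)) * (4 * deriv f t + deriv (deriv (deriv f)) t)) 0 := by
    have hs : t + Real.arctan 0 ∈ I := by simpa using ht
    have hp : HasDerivAt (fun s : ℝ => 2 * s) 2 0 := by
      simpa using (hasDerivAt_id (0 : ℝ)).const_mul 2
    have hq : HasDerivAt (fun s : ℝ => 1 / (1 + s ^ 2)) 0 0 := by
      have h : HasDerivAt (fun s : ℝ => 1 + s ^ 2) 0 0 := by
        simpa using (hasDerivAt_pow 2 (0 : ℝ)).const_add 1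
      simpa using h.fun_inv (by simp)
    have h := ((((d0 _ hs).comp 0 (ha 0)).const_mul 2).add
      (((hp.mul ((d1 _ hs).comp 0 (ha 0))).add ((d2 _ hs).comp 0 (ha 0))).mul hq)).const_mul
        (1 / (2 * f t))
    refine h.congr_deriv ?_
    simp only [Function.comp, Real.arctan_zero, add_zero]
    ring
  have hL : ∀ g : ℝ → ℝ, iteratedDeriv 3 g = deriv (deriv (deriv g)) := by
    intro g
    simp [iteratedDeriv_succ, iteratedDeriv_zero]
  rw [hL, hL, ((e0.deriv.trans e1).deriv.trans e2).deriv_eq, e3.deriv]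
  field_simp
  ring
end

section
/- For every (a₀, a₁, a₂, a₃) ∈ ℝ⁴ with a₀ > 0, a₁ ≠ 0 and 2a₀a₂ − a₁² + 4a₀² > 0, there exist ε > 0 and a smooth function f : (−ε, ε) → ℝ with f > 0 and D(t) = 2f(t)f''(t) − f'(t)² + 4f(t)² > 0 on (−ε, ε), with (f(0), f'(0), f''(0), f'''(0)) = (a₀, a₁, a₂, a₃), and such that the function t ↦ 2f(t)²·(4f'(t) + f'''(t))·D(t)^{−3/2} is constant on (−ε, ε). Moreover, any two smooth functions with these properties agree on a neighborhood of 0. -/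
open Real Set

/-- `f` is a solution of the Landsberg ODE (17) on `(−ε, ε)` with the admissibility
conditions `f > 0`, `D > 0`. -/
def IsLandsbergSolution (ε : ℝ) (f : ℝ → ℝ) : Prop :=
  ContDiffOn ℝ (⊤ : ℕ∞) f (Ioo (-ε) ε) ∧
  (∀ t ∈ Ioo (-ε) ε, 0 < f t) ∧
  (∀ t ∈ Ioo (-ε) ε, 0 < Dfun f t) ∧
  ∃ k : ℝ, ∀ t ∈ Ioo (-ε) ε,
    2 * (f t) ^ 2 * (4 * deriv f t + iteratedDeriv 3 f t) * (Dfun f t) ^ (-(3 : ℝ) / 2) = k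

/-- `f` has the prescribed 3-jet at `0`. -/
def HasInitialValues (f : ℝ → ℝ) (a₀ a₁ a₂ a₃ : ℝ) : Prop :=
  f 0 = a₀ ∧ deriv f 0 = a₁ ∧ deriv (deriv f) 0 = a₂ ∧ iteratedDeriv 3 f 0 = a₃

open Filter Topology

/-- The discriminant as a function of the 2-jet. -/
noncomputable def jetD (p : ℝ × ℝ × ℝ) : ℝ :=
  2 * p.1 * p.2.2 - p.2.1 ^ 2 + 4 * p.1 ^ 2

/-- The first-order vector field on 2-jets, with parameter `k`. -/
noncomputable def jetV (k : ℝ) (p : ℝ × ℝ × ℝ) : ℝ × ℝ × ℝ :=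
  (p.2.1, p.2.2, k * jetD p ^ ((3 : ℝ) / 2) / (2 * p.1 ^ 2) - 4 * p.2.1)

lemma continuous_jetD : Continuous jetD := by
  unfold jetD; fun_prop

lemma contDiffAt_jetV (k : ℝ) {n : WithTop ℕ∞} (p : ℝ × ℝ × ℝ) (h0 : 0 < p.1) (hD : 0 < jetD p) :
    ContDiffAt ℝ n (jetV k) p := by
  have hj : ContDiffAt ℝ n jetD p := by unfold jetD; fun_prop
  have hr : ContDiffAt ℝ n (fun q => jetD q ^ ((3 : ℝ) / 2)) p :=
    hj.rpow_const_of_ne hD.ne'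
  unfold jetV
  refine ContDiffAt.prodMk (by fun_prop) (ContDiffAt.prodMk (by fun_prop) ?_)
  refine ContDiffAt.sub (ContDiffAt.div (contDiffAt_const.mul hr) (by fun_prop) ?_) (by fun_prop)
  positivity

lemma iter3 (f : ℝ → ℝ) : iteratedDeriv 3 f = deriv (deriv (deriv f)) := by
  simp [iteratedDeriv_succ, iteratedDeriv_zero]

lemma solve_third {x E D k : ℝ} (hx : 0 < x) (hD : 0 < D) :
    2 * x ^ 2 * E * D ^ (-(3 : ℝ) / 2) = k ↔ E = k * D ^ ((3 : ℝ) / 2) / (2 * x ^ 2) := by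
  have h : D ^ (-(3 : ℝ) / 2) = (D ^ ((3 : ℝ) / 2))⁻¹ := by
    rw [neg_div, Real.rpow_neg hD.le]
  have hp : 0 < D ^ ((3 : ℝ) / 2) := Real.rpow_pos_of_pos hD _
  rw [h, eq_div_iff (by positivity), ← div_eq_mul_inv, div_eq_iff hp.ne']
  constructor <;> intro h <;> linarith

lemma smooth_of_curve {k ε : ℝ} {α : ℝ → ℝ × ℝ × ℝ}
    (hα : ∀ t ∈ Ioo (-ε) ε, HasDerivAt α (jetV k (α t)) t)
    (h0 : ∀ t ∈ Ioo (-ε) ε, 0 < (α t).1) (hD : ∀ t ∈ Ioo (-ε) ε, 0 < jetD (α t)) :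
    ContDiffOn ℝ (⊤ : ℕ∞) α (Ioo (-ε) ε) := by
  have hdiff : DifferentiableOn ℝ α (Ioo (-ε) ε) := fun t ht =>
    (hα t ht).differentiableAt.differentiableWithinAt
  refine contDiffOn_infty.2 fun n => ?_
  induction n with
  | zero => simpa using hdiff.continuousOn
  | succ n ih =>
    have := (contDiffOn_succ_iff_deriv_of_isOpen (𝕜 := ℝ) (n := (n : WithTop ℕ∞)) (f := α)
      (isOpen_Ioo (a := -ε) (b := ε))).2 ⟨hdiff, by simp, ?_⟩
    · simpa using this
    · refine ContDiffOn.congr (f := fun t => jetV k (α t)) ?_ fun t ht => (hα t ht).deriv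
      intro t ht
      exact (contDiffAt_jetV k (α t) (h0 t ht) (hD t ht)).comp_contDiffWithinAt t (ih t ht)

lemma hasDerivAt_fst_comp {E F : Type*} [NormedAddCommGroup E] [NormedSpace ℝ E]
    [NormedAddCommGroup F] [NormedSpace ℝ F] {g : ℝ → E × F} {v : E × F} {t : ℝ}
    (h : HasDerivAt g v t) : HasDerivAt (fun s => (g s).1) v.1 t :=
  (ContinuousLinearMap.fst ℝ E F).hasFDerivAt.comp_hasDerivAt t h

lemma hasDerivAt_snd_comp {E F : Type*} [NormedAddCommGroup E] [NormedSpace ℝ E]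
    [NormedAddCommGroup F] [NormedSpace ℝ F] {g : ℝ → E × F} {v : E × F} {t : ℝ}
    (h : HasDerivAt g v t) : HasDerivAt (fun s => (g s).2) v.2 t :=
  (ContinuousLinearMap.snd ℝ E F).hasFDerivAt.comp_hasDerivAt t h

lemma existence_part (a₀ a₁ a₂ a₃ : ℝ) (h₀ : 0 < a₀)
    (h₂ : 0 < 2 * a₀ * a₂ - a₁ ^ 2 + 4 * a₀ ^ 2) :
    ∃ ε > 0, ∃ f : ℝ → ℝ, IsLandsbergSolution ε f ∧ HasInitialValues f a₀ a₁ a₂ a₃ := by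
  set k : ℝ := 2 * a₀ ^ 2 * (4 * a₁ + a₃) *
    (2 * a₀ * a₂ - a₁ ^ 2 + 4 * a₀ ^ 2) ^ (-(3 : ℝ) / 2) with hk
  have hk' := (solve_third h₀ h₂).1 hk.symm
  obtain ⟨α, hα0, ε₁, hε₁, hα⟩ :=
    (contDiffAt_jetV k (n := 1) (a₀, a₁, a₂) h₀ h₂
      ).exists_forall_mem_closedBall_exists_eq_forall_mem_Ioo_hasDerivAt₀ 0
  have hc : ContinuousAt α 0 := (hα 0 (by constructor <;> linarith)).continuousAt
  have e1 : ∀ᶠ t in 𝓝 (0 : ℝ), 0 < (α t).1 :=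
    (continuousAt_const (y := (0 : ℝ))).eventually_lt (continuous_fst.continuousAt.comp hc)
      (by simp [hα0, h₀])
  have e2 : ∀ᶠ t in 𝓝 (0 : ℝ), 0 < jetD (α t) :=
    (continuousAt_const (y := (0 : ℝ))).eventually_lt (continuous_jetD.continuousAt.comp hc)
      (by simpa [hα0, jetD] using h₂)
  obtain ⟨ε₂, hε₂, he⟩ := Metric.eventually_nhds_iff_ball.1 (e1.and e2)
  set ε := min ε₁ ε₂ with hε
  have hεpos : 0 < ε := lt_min hε₁ hε₂
  have hA : ∀ t ∈ Ioo (-ε) ε, HasDerivAt α (jetV k (α t)) t := fun t ht =>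
    hα t ⟨by linarith [ht.1, min_le_left ε₁ ε₂], by linarith [ht.2, min_le_left ε₁ ε₂]⟩
  have hB : ∀ t ∈ Ioo (-ε) ε, 0 < (α t).1 ∧ 0 < jetD (α t) := fun t ht => he t (by
    rw [Real.ball_eq_Ioo]
    exact ⟨by linarith [ht.1, min_le_right ε₁ ε₂], by linarith [ht.2, min_le_right ε₁ ε₂]⟩)
  have hs := smooth_of_curve hA (fun t ht => (hB t ht).1) (fun t ht => (hB t ht).2)
  have hd0 : ∀ t ∈ Ioo (-ε) ε, deriv (fun s => (α s).1) t = (α t).2.1 := fun t ht =>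
    (hasDerivAt_fst_comp (hA t ht)).deriv
  have hd1 : ∀ t ∈ Ioo (-ε) ε, deriv (fun s => (α s).2.1) t = (α t).2.2 := fun t ht =>
    (hasDerivAt_fst_comp (hasDerivAt_snd_comp (hA t ht))).deriv
  have hd2 : ∀ t ∈ Ioo (-ε) ε, deriv (fun s => (α s).2.2) t = (jetV k (α t)).2.2 := fun t ht =>
    (hasDerivAt_snd_comp (hasDerivAt_snd_comp (hA t ht))).deriv
  have hdd : ∀ t ∈ Ioo (-ε) ε, deriv (deriv (fun s => (α s).1)) t = (α t).2.2 := fun t ht => by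
    rw [← hd1 t ht]
    exact EventuallyEq.deriv_eq (eventually_of_mem (isOpen_Ioo.mem_nhds ht) hd0)
  have hddd : ∀ t ∈ Ioo (-ε) ε, iteratedDeriv 3 (fun s => (α s).1) t = (jetV k (α t)).2.2 :=
    fun t ht => by
      rw [← hd2 t ht, iter3]
      exact EventuallyEq.deriv_eq (eventually_of_mem (isOpen_Ioo.mem_nhds ht) hdd)
  have hDf : ∀ t ∈ Ioo (-ε) ε, Dfun (fun s => (α s).1) t = jetD (α t) := fun t ht => by
    simp only [Dfun, jetD, hd0 t ht, hdd t ht]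
  have hz : (0 : ℝ) ∈ Ioo (-ε) ε := ⟨by linarith, hεpos⟩
  refine ⟨ε, hεpos, fun s => (α s).1, ⟨?_, fun t ht => (hB t ht).1, ?_, k, ?_⟩, ?_, ?_, ?_, ?_⟩
  · exact contDiff_fst.comp_contDiffOn hs
  · intro t ht
    rw [hDf t ht]; exact (hB t ht).2
  · intro t ht
    rw [hDf t ht, solve_third (hB t ht).1 (hB t ht).2, hd0 t ht, hddd t ht]
    simp only [jetV]; ring
  · simp [hα0]
  · rw [hd0 0 hz, hα0]
  · rw [hdd 0 hz, hα0]
  · rw [hddd 0 hz, hα0]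
    simp only [jetV, jetD]
    linarith

lemma curve_of_solution {a₀ a₁ a₂ a₃ ε : ℝ} {f : ℝ → ℝ} (hε : 0 < ε)
    (hf : IsLandsbergSolution ε f) (hi : HasInitialValues f a₀ a₁ a₂ a₃) :
    ∀ t ∈ Ioo (-ε) ε, HasDerivAt (fun t => (f t, deriv f t, deriv (deriv f) t))
      (jetV (2 * a₀ ^ 2 * (4 * a₁ + a₃) * (2 * a₀ * a₂ - a₁ ^ 2 + 4 * a₀ ^ 2) ^ (-(3 : ℝ) / 2))
        (f t, deriv f t, deriv (deriv f) t)) t := by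
  obtain ⟨hs, hp, hD, k, hk⟩ := hf
  obtain ⟨i0, i1, i2, i3⟩ := hi
  have hz : (0 : ℝ) ∈ Ioo (-ε) ε := ⟨by linarith, hε⟩
  have hk0 := hk 0 hz
  simp only [Dfun, i0, i1, i2, i3] at hk0
  rw [hk0]
  have hs1 := (contDiffOn_infty_iff_deriv_of_isOpen isOpen_Ioo).1 hs
  have hs2 := (contDiffOn_infty_iff_deriv_of_isOpen isOpen_Ioo).1 hs1.2
  have hs3 := (contDiffOn_infty_iff_deriv_of_isOpen isOpen_Ioo).1 hs2.2
  intro t ht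
  have hn := isOpen_Ioo.mem_nhds ht
  have d0 := (hs1.1.differentiableAt hn).hasDerivAt
  have d1 := (hs2.1.differentiableAt hn).hasDerivAt
  have d2 := (hs3.1.differentiableAt hn).hasDerivAt
  have h3 := (solve_third (hp t ht) (hD t ht)).1 (hk t ht)
  rw [iter3] at h3
  have h4 : deriv (deriv (deriv f)) t =
      k * Dfun f t ^ ((3 : ℝ) / 2) / (2 * f t ^ 2) - 4 * deriv f t := by linarith
  rw [h4] at d2
  exact d0.prodMk (d1.prodMk d2)

lemma uniqueness_part (a₀ a₁ a₂ a₃ : ℝ) (h₀ : 0 < a₀)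
    (h₂ : 0 < 2 * a₀ * a₂ - a₁ ^ 2 + 4 * a₀ ^ 2) (ε₁ : ℝ) (hε₁ : ε₁ > 0) (ε₂ : ℝ) (hε₂ : ε₂ > 0)
    (f₁ f₂ : ℝ → ℝ)
    (hf₁ : IsLandsbergSolution ε₁ f₁) (hi₁ : HasInitialValues f₁ a₀ a₁ a₂ a₃)
    (hf₂ : IsLandsbergSolution ε₂ f₂) (hi₂ : HasInitialValues f₂ a₀ a₁ a₂ a₃) :
    ∃ δ > 0, ∀ t ∈ Ioo (-δ) δ, f₁ t = f₂ t := by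
  have c₁ := curve_of_solution hε₁ hf₁ hi₁
  have c₂ := curve_of_solution hε₂ hf₂ hi₂
  set k := 2 * a₀ ^ 2 * (4 * a₁ + a₃) * (2 * a₀ * a₂ - a₁ ^ 2 + 4 * a₀ ^ 2) ^ (-(3 : ℝ) / 2)
  obtain ⟨K, s, hs, hL⟩ :=
    (contDiffAt_jetV k (n := 1) (a₀, a₁, a₂) h₀ h₂).exists_lipschitzOnWith
  have key : ∀ (ε : ℝ) (f : ℝ → ℝ), 0 < ε → HasInitialValues f a₀ a₁ a₂ a₃ →
      (∀ t ∈ Ioo (-ε) ε, HasDerivAt (fun t => (f t, deriv f t, deriv (deriv f) t))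
        (jetV k (f t, deriv f t, deriv (deriv f) t)) t) →
      ∀ᶠ t in 𝓝 (0 : ℝ), HasDerivAt (fun t => (f t, deriv f t, deriv (deriv f) t))
        (jetV k (f t, deriv f t, deriv (deriv f) t)) t ∧
        (f t, deriv f t, deriv (deriv f) t) ∈ s := by
    intro ε f hε hi hc
    obtain ⟨i0, i1, i2, i3⟩ := hi
    have hz : (0 : ℝ) ∈ Ioo (-ε) ε := ⟨by linarith, hε⟩
    refine (eventually_of_mem (isOpen_Ioo.mem_nhds hz) hc).and ?_
    refine (hc 0 hz).continuousAt.eventually_mem ?_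
    simpa only [i0, i1, i2] using hs
  have hu := ODE_solution_unique_of_eventually (v := fun _ => jetV k) (s := fun _ => s) (K := K)
    (t₀ := 0) (Eventually.of_forall fun _ => hL) (key ε₁ f₁ hε₁ hi₁ c₁) (key ε₂ f₂ hε₂ hi₂ c₂)
    (by
      obtain ⟨i0, i1, i2, i3⟩ := hi₁
      obtain ⟨j0, j1, j2, j3⟩ := hi₂
      simp only [i0, i1, i2, j0, j1, j2])
  obtain ⟨δ, hδ, h⟩ := Metric.eventually_nhds_iff_ball.1 hu
  refine ⟨δ, hδ, fun t ht => ?_⟩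
  have := h t (by rw [Real.ball_eq_Ioo]; simpa using ht)
  exact congrArg Prod.fst this

theorem landsberg_ode_existence_uniqueness
    (a₀ a₁ a₂ a₃ : ℝ) (h₀ : 0 < a₀) (h₁ : a₁ ≠ 0)
    (h₂ : 0 < 2 * a₀ * a₂ - a₁ ^ 2 + 4 * a₀ ^ 2) :
    (∃ ε > 0, ∃ f : ℝ → ℝ, IsLandsbergSolution ε f ∧ HasInitialValues f a₀ a₁ a₂ a₃) ∧
    (∀ ε₁ > 0, ∀ ε₂ > 0, ∀ f₁ f₂ : ℝ → ℝ,
      IsLandsbergSolution ε₁ f₁ → HasInitialValues f₁ a₀ a₁ a₂ a₃ →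
      IsLandsbergSolution ε₂ f₂ → HasInitialValues f₂ a₀ a₁ a₂ a₃ →
      ∃ δ > 0, ∀ t ∈ Ioo (-δ) δ, f₁ t = f₂ t) := by
  exact ⟨existence_part a₀ a₁ a₂ a₃ h₀ h₂,
    uniqueness_part a₀ a₁ a₂ a₃ h₀ h₂⟩
end

section
/- Fix c ∈ ℝ. For every (a₀, a₁, a₂, a₃) ∈ ℝ⁴ with a₀ > 0, a₁ ≠ 0 and 2a₀a₂ − a₁² + 4a₀² > 0, there exist ε > 0 and a smooth function f : (−ε, ε) → ℝ with f > 0, D(t) = 2f(t)f''(t) − f'(t)² + 4f(t)² > 0 and 2f(t)·sin t + f'(t)·cos t ≠ 0 on (−ε, ε), with (f(0), f'(0), f''(0), f'''(0)) = (a₀, a₁, a₂, a₃), and such that, setting P(t) = (f(t)·D(t))^{1/2} / [(2f(t))^{3/2}·(−2f(t)·sin t − f'(t)·cos t)] and Q(t) = √(2f(t))·(2f(t)·sin t + f'(t)·cos t)/D(t), the identity −(d/dt)[P'(t)·Q(t)] · Q(t) · P(t)^{−1} = c holds on (−ε, ε). Moreover, any two smooth functions with these properties agree on a neighborhood of 0.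 -/
open Real Set

/-- `P(t) = (f(t)·D(t))^{1/2} / [(2f(t))^{3/2}·(−2f(t)·sin t − f'(t)·cos t)]`. -/
noncomputable def Pfun (f : ℝ → ℝ) (t : ℝ) : ℝ :=
  Real.sqrt (f t * Dfun f t) /
    ((2 * f t) ^ ((3 : ℝ) / 2) * (-2 * f t * Real.sin t - deriv f t * Real.cos t))

/-- `Q(t) = √(2f(t))·(2f(t)·sin t + f'(t)·cos t)/D(t)`. -/
noncomputable def Qfun (f : ℝ → ℝ) (t : ℝ) : ℝ :=
  Real.sqrt (2 * f t) * (2 * f t * Real.sin t + deriv f t * Real.cos t) / Dfun f t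

/-- `f` is a solution of the constant flag curvature ODE (20) on `(−ε, ε)` with the
admissibility conditions. -/
def IsCurvatureSolution (c ε : ℝ) (f : ℝ → ℝ) : Prop :=
  ContDiffOn ℝ (⊤ : ℕ∞) f (Ioo (-ε) ε) ∧
  (∀ t ∈ Ioo (-ε) ε, 0 < f t) ∧
  (∀ t ∈ Ioo (-ε) ε, 0 < Dfun f t) ∧
  (∀ t ∈ Ioo (-ε) ε, 2 * f t * Real.sin t + deriv f t * Real.cos t ≠ 0) ∧
  (∀ t ∈ Ioo (-ε) ε,
    -(deriv (fun τ => deriv (Pfun f) τ * Qfun f τ) t) * Qfun f t * (Pfun f t)⁻¹ = c)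

open Filter Topology

namespace CurvODE

noncomputable def SS (t x y : ℝ) : ℝ := 2 * x * Real.sin t + y * Real.cos t

noncomputable def RR (t x y z : ℝ) : ℝ := 8 * x ^ 2 * z ^ 2 * SS t x y / Real.sqrt (2 * x)

noncomputable def GG (t x y z : ℝ) : ℝ :=
  4 * x * z ^ 2 * SS t x y ^ 2 + y ^ 2 / (2 * x) - 2 * x

/-- Derivative of `GG` along a curve. -/
noncomputable def GD (t x y z x' y' z' : ℝ) : ℝ :=
  4 * x' * z ^ 2 * SS t x y ^ 2 + 8 * x * z * z' * SS t x y ^ 2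
    + 8 * x * z ^ 2 * SS t x y *
      (2 * x' * Real.sin t + 2 * x * Real.cos t + (y' * Real.cos t - y * Real.sin t))
    + (2 * y * y' * (2 * x) - y ^ 2 * (2 * x')) / (2 * x) ^ 2 - 2 * x'

abbrev E5 := ℝ × ℝ × ℝ × ℝ × ℝ

/-- The first-order autonomous vector field of the problem. -/
noncomputable def VV (c : ℝ) (v : E5) : E5 :=
  (1, v.2.2.1, GG v.1 v.2.1 v.2.2.1 v.2.2.2.1,
    v.2.2.2.2 * RR v.1 v.2.1 v.2.2.1 v.2.2.2.1,
    -c * v.2.2.2.1 * RR v.1 v.2.1 v.2.2.1 v.2.2.2.1)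

noncomputable def PP (x S D : ℝ) : ℝ := Real.sqrt (x * D) / ((2 * x) ^ ((3 : ℝ) / 2) * (-S))

lemma rpow_sq {x : ℝ} (hx : 0 < x) : ((2 * x) ^ ((3 : ℝ) / 2)) ^ 2 = 8 * x ^ 3 := by
  rw [← Real.rpow_natCast, ← Real.rpow_mul (by positivity)]
  norm_num
  rw [mul_pow]; norm_num

lemma PP_fwd {x S D : ℝ} (hx : 0 < x) (hS : S ≠ 0) (hD : 0 < D) :
    D = 8 * x ^ 2 * (PP x S D) ^ 2 * S ^ 2 ∧ PP x S D * S < 0 := by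
  have h1 := rpow_sq hx
  have h2 : 0 < (2 * x) ^ ((3 : ℝ) / 2) := by positivity
  have h3 : Real.sqrt (x * D) ^ 2 = x * D := Real.sq_sqrt (by positivity)
  have h4 : 0 < Real.sqrt (x * D) := Real.sqrt_pos.2 (by positivity)
  unfold PP
  generalize (2 * x) ^ ((3 : ℝ) / 2) = w at *
  constructor
  · rw [div_pow, mul_pow, h3, h1]
    field_simp
  · have : Real.sqrt (x * D) / (w * -S) * S = -(Real.sqrt (x * D) / w) := by
      field_simp
    rw [this]
    have : 0 < Real.sqrt (x * D) / w := by positivity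
    linarith

lemma PP_bwd {x S D p : ℝ} (hx : 0 < x) (hp : p * S < 0) (hD : D = 8 * x ^ 2 * p ^ 2 * S ^ 2) :
    PP x S D = p := by
  have hS : S ≠ 0 := by rintro rfl; simp at hp
  have hp0 : p ≠ 0 := by rintro rfl; simp at hp
  have hDp : 0 < D := by rw [hD]; positivity
  obtain ⟨h1, h2⟩ := PP_fwd hx hS hDp
  have h3 : (PP x S D) ^ 2 = p ^ 2 := by
    have : 8 * x ^ 2 * S ^ 2 * (PP x S D) ^ 2 = 8 * x ^ 2 * S ^ 2 * p ^ 2 := by linarith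
    exact mul_left_cancel₀ (by positivity) this
  rcases sq_eq_sq_iff_eq_or_eq_neg.1 h3 with h | h
  · exact h
  · rw [h] at h2; linarith

lemma Pfun_eq (f : ℝ → ℝ) (t : ℝ) : Pfun f t = PP (f t) (SS t (f t) (deriv f t)) (Dfun f t) := by
  unfold Pfun PP SS
  congr 2
  ring

lemma hasDerivAt_GG {x y z : ℝ → ℝ} {t x' y' z' : ℝ} (hx : HasDerivAt x x' t)
    (hy : HasDerivAt y y' t) (hz : HasDerivAt z z' t) (h0 : x t ≠ 0) :
    HasDerivAt (fun s => GG s (x s) (y s) (z s)) (GD t (x t) (y t) (z t) x' y' z') t := by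
  have hS : HasDerivAt (fun s => SS s (x s) (y s))
      (2 * x' * Real.sin t + 2 * x t * Real.cos t + (y' * Real.cos t - y t * Real.sin t)) t := by
    unfold SS
    refine (((hx.const_mul 2).mul (Real.hasDerivAt_sin t)).add
      (hy.mul (Real.hasDerivAt_cos t))).congr_deriv ?_
    ring
  unfold GG
  refine (((((hx.const_mul 4).mul (hz.pow 2)).mul (hS.pow 2)).add
    ((hy.pow 2).div (hx.const_mul 2) (by simpa using h0))).sub (hx.const_mul 2)).congr_deriv ?_
  unfold GD
  simp
  ring

lemma GD_split (t x y z x' y' z' : ℝ) :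
    GD t x y z x' y' z' = GD t x y z x' y' 0 + 8 * x * z * z' * SS t x y ^ 2 := by
  unfold GD; ring

lemma contDiffOn_VV (c : ℝ) : ContDiffOn ℝ (⊤ : ℕ∞) (VV c) {v : E5 | 0 < v.2.1} := by
  intro v hv
  have hv' : (0 : ℝ) < v.2.1 := hv
  apply ContDiffAt.contDiffWithinAt
  have e1 : ContDiffAt ℝ (⊤ : ℕ∞) (fun v : E5 => v.1) v := by fun_prop
  have e2 : ContDiffAt ℝ (⊤ : ℕ∞) (fun v : E5 => v.2.1) v := by fun_prop
  have e3 : ContDiffAt ℝ (⊤ : ℕ∞) (fun v : E5 => v.2.2.1) v := by fun_prop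
  have e4 : ContDiffAt ℝ (⊤ : ℕ∞) (fun v : E5 => v.2.2.2.1) v := by fun_prop
  have e5 : ContDiffAt ℝ (⊤ : ℕ∞) (fun v : E5 => v.2.2.2.2) v := by fun_prop
  have eS : ContDiffAt ℝ (⊤ : ℕ∞) (fun v : E5 => SS v.1 v.2.1 v.2.2.1) v := by
    unfold SS
    exact ((contDiffAt_const.mul e2).mul e1.sin).add (e3.mul e1.cos)
  have eR : ContDiffAt ℝ (⊤ : ℕ∞) (fun v : E5 => RR v.1 v.2.1 v.2.2.1 v.2.2.2.1) v := by
    unfold RR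
    refine (((contDiffAt_const.mul (e2.pow 2)).mul (e4.pow 2)).mul eS).div
      ((contDiffAt_const.mul e2).sqrt (by positivity)) ?_
    have : 0 < Real.sqrt (2 * v.2.1) := Real.sqrt_pos.2 (by positivity)
    exact this.ne'
  have eG : ContDiffAt ℝ (⊤ : ℕ∞) (fun v : E5 => GG v.1 v.2.1 v.2.2.1 v.2.2.2.1) v := by
    unfold GG
    exact ((((contDiffAt_const.mul e2).mul (e4.pow 2)).mul (eS.pow 2)).add
      ((e3.pow 2).div (contDiffAt_const.mul e2) (by positivity))).sub (contDiffAt_const.mul e2)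
  exact contDiffAt_const.prodMk (e3.prodMk (eG.prodMk ((e5.mul eR).prodMk
    ((contDiffAt_const.mul e4).mul eR))))

lemma isOpen_dom : IsOpen {v : E5 | 0 < v.2.1} :=
  isOpen_lt continuous_const (by fun_prop)

lemma smooth_curve {E : Type*} [NormedAddCommGroup E] [NormedSpace ℝ E] {V : E → E} {U : Set E}
    {s : Set ℝ} (hs : IsOpen s) (hV : ContDiffOn ℝ (⊤ : ℕ∞) V U) {α : ℝ → E}
    (hα : ∀ t ∈ s, HasDerivAt α (V (α t)) t) (hm : MapsTo α s U) :
    ContDiffOn ℝ (⊤ : ℕ∞) α s := by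
  rw [contDiffOn_infty] at *
  intro n
  induction n with
  | zero =>
    exact contDiffOn_zero.2 fun t ht => (hα t ht).continuousAt.continuousWithinAt
  | succ n ih =>
    push_cast
    rw [contDiffOn_succ_iff_deriv_of_isOpen hs]
    refine ⟨fun t ht => (hα t ht).differentiableAt.differentiableWithinAt, by simp, ?_⟩
    exact ((hV n).comp ih hm).congr fun t ht => (hα t ht).deriv

/-- An initial value. -/
noncomputable def P0 (a₀ a₁ a₂ : ℝ) : ℝ := PP a₀ a₁ (2 * a₀ * a₂ - a₁ ^ 2 + 4 * a₀ ^ 2)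

/-- An initial value. -/
noncomputable def P1 (a₀ a₁ a₂ a₃ : ℝ) : ℝ :=
  (a₃ - GD 0 a₀ a₁ (P0 a₀ a₁ a₂) a₁ a₂ 0) / (8 * a₀ * P0 a₀ a₁ a₂ * a₁ ^ 2)

noncomputable def V0 (a₀ a₁ a₂ a₃ : ℝ) : E5 :=
  (0, a₀, a₁, P0 a₀ a₁ a₂, P1 a₀ a₁ a₂ a₃ / RR 0 a₀ a₁ (P0 a₀ a₁ a₂))

lemma RR_ne {t x y z : ℝ} (hx : 0 < x) (hz : z * SS t x y < 0) : RR t x y z ≠ 0 := by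
  have hS : SS t x y ≠ 0 := fun h => by simp [h] at hz
  have hp0 : z ≠ 0 := by rintro rfl; simp at hz
  have : 0 < Real.sqrt (2 * x) := Real.sqrt_pos.2 (by positivity)
  unfold RR
  positivity

lemma Q_eq {f : ℝ → ℝ} {t p : ℝ} (hx : 0 < f t) (hz : p * SS t (f t) (deriv f t) < 0)
    (hD : Dfun f t = 8 * f t ^ 2 * p ^ 2 * SS t (f t) (deriv f t) ^ 2) :
    Qfun f t = (RR t (f t) (deriv f t) p)⁻¹ := by
  have hS : SS t (f t) (deriv f t) ≠ 0 := fun h => by simp [h] at hz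
  have hp0 : p ≠ 0 := by rintro rfl; simp at hz
  have : 0 < Real.sqrt (2 * f t) := Real.sqrt_pos.2 (by positivity)
  have e : Qfun f t = Real.sqrt (2 * f t) * SS t (f t) (deriv f t) / Dfun f t := rfl
  rw [e, hD]
  unfold RR
  field_simp

lemma SS_zero (x y : ℝ) : SS 0 x y = y := by simp [SS]

lemma forward {c ε : ℝ} {f : ℝ → ℝ} {a₀ a₁ a₂ a₃ : ℝ} (hε : 0 < ε)
    (hf : IsCurvatureSolution c ε f) (hi : HasInitialValues f a₀ a₁ a₂ a₃) :
    ∃ α : ℝ → E5, (∀ t, (α t).2.1 = f t) ∧ α 0 = V0 a₀ a₁ a₂ a₃ ∧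
      ∀ t ∈ Ioo (-ε) ε, HasDerivAt α (VV c (α t)) t := by
  obtain ⟨hsm, hpos, hD, hS, hode⟩ := hf
  obtain ⟨i0, i1, i2, i3⟩ := hi
  have ho : IsOpen (Ioo (-ε) ε) := isOpen_Ioo
  have h0 : (0 : ℝ) ∈ Ioo (-ε) ε := ⟨by linarith, hε⟩
  have s1 := ((contDiffOn_infty_iff_deriv_of_isOpen ho).1 hsm).2
  have s2 := ((contDiffOn_infty_iff_deriv_of_isOpen ho).1 s1).2
  have d {g : ℝ → ℝ} (hg : ContDiffOn ℝ (⊤ : ℕ∞) g (Ioo (-ε) ε)) {t : ℝ} (ht : t ∈ Ioo (-ε) ε) :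
      HasDerivAt g (deriv g t) t :=
    (((contDiffOn_infty_iff_deriv_of_isOpen ho).1 hg).1.differentiableAt
      (ho.mem_nhds ht)).hasDerivAt
  have sD : ContDiffOn ℝ (⊤ : ℕ∞) (Dfun f) (Ioo (-ε) ε) := by
    unfold Dfun
    exact (((contDiffOn_const.mul hsm).mul s2).sub (s1.pow 2)).add (contDiffOn_const.mul (hsm.pow 2))
  have sS : ContDiffOn ℝ (⊤ : ℕ∞) (fun t => SS t (f t) (deriv f t)) (Ioo (-ε) ε) := by
    unfold SS
    exact ((contDiffOn_const.mul hsm).mul Real.contDiff_sin.contDiffOn).add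
      (s1.mul Real.contDiff_cos.contDiffOn)
  have sP : ContDiffOn ℝ (⊤ : ℕ∞) (Pfun f) (Ioo (-ε) ε) := by
    have : Pfun f = fun t => PP (f t) (SS t (f t) (deriv f t)) (Dfun f t) := by
      ext t; exact Pfun_eq f t
    rw [this]
    unfold PP
    refine ContDiffOn.div ?_ (ContDiffOn.mul ?_ sS.neg) ?_
    · exact (hsm.mul sD).sqrt fun t ht => (mul_pos (hpos t ht) (hD t ht)).ne'
    · exact (contDiffOn_const.mul hsm).rpow_const_of_ne fun t ht => by
        have := hpos t ht
        positivity
    · intro t ht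
      have := hpos t ht
      exact mul_ne_zero (by positivity) (neg_ne_zero.2 (hS t ht))
  have sP' := ((contDiffOn_infty_iff_deriv_of_isOpen ho).1 sP).2
  have sQ : ContDiffOn ℝ (⊤ : ℕ∞) (Qfun f) (Ioo (-ε) ε) := by
    refine ContDiffOn.div (ContDiffOn.mul ?_ sS) sD fun t ht => (hD t ht).ne'
    exact (contDiffOn_const.mul hsm).sqrt fun t ht => by
      have := hpos t ht
      positivity
  have key : ∀ t ∈ Ioo (-ε) ε,
      Dfun f t = 8 * f t ^ 2 * Pfun f t ^ 2 * SS t (f t) (deriv f t) ^ 2 ∧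
      Pfun f t * SS t (f t) (deriv f t) < 0 := by
    intro t ht
    rw [Pfun_eq]
    exact PP_fwd (hpos t ht) (hS t ht) (hD t ht)
  have f2 : ∀ t ∈ Ioo (-ε) ε, deriv (deriv f) t = GG t (f t) (deriv f t) (Pfun f t) := by
    intro t ht
    have h1 := (key t ht).1
    have h2 := hpos t ht
    unfold Dfun at h1
    unfold GG
    field_simp
    linarith
  have qe : ∀ t ∈ Ioo (-ε) ε, Qfun f t = (RR t (f t) (deriv f t) (Pfun f t))⁻¹ :=
    fun t ht => Q_eq (hpos t ht) (key t ht).2 (key t ht).1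
  have rne : ∀ t ∈ Ioo (-ε) ε, RR t (f t) (deriv f t) (Pfun f t) ≠ 0 :=
    fun t ht => RR_ne (hpos t ht) (key t ht).2
  refine ⟨fun t => (t, f t, deriv f t, Pfun f t, deriv (Pfun f) t * Qfun f t), fun t => rfl, ?_, ?_⟩
  · have hP0 : Pfun f 0 = P0 a₀ a₁ a₂ := by
      rw [Pfun_eq, SS_zero]
      simp only [P0, Dfun, i0, i1, i2]
    have hP1 : deriv (Pfun f) 0 = P1 a₀ a₁ a₂ a₃ := by
      have e1 := hasDerivAt_GG (d hsm h0) (d s1 h0) (d sP h0) (hpos 0 h0).ne'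
      have e2 : deriv (deriv (deriv f)) 0 = _ :=
        (e1.congr_of_eventuallyEq (by
          filter_upwards [ho.mem_nhds h0] with t ht using f2 t ht)).deriv
      have e3 : deriv (deriv (deriv f)) 0 = a₃ := by
        rw [← i3]; simp [iteratedDeriv_succ, iteratedDeriv_zero]
      rw [e3, GD_split, SS_zero, i0, i1, i2, hP0] at e2
      have k := (key 0 h0).2
      have p0 := hpos 0 h0
      rw [SS_zero, i1, hP0] at k
      rw [i0] at p0
      have ha1 : a₁ ≠ 0 := by rintro rfl; simp at k
      have hp : P0 a₀ a₁ a₂ ≠ 0 := fun h => by simp [h] at k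
      unfold P1
      rw [eq_div_iff (by positivity)]
      linarith
    simp only [V0]
    rw [qe 0 h0, hP0, hP1, i0, i1]
    rfl
  · intro t ht
    have q' : HasDerivAt (fun τ => deriv (Pfun f) τ * Qfun f τ)
        (-c * Pfun f t * RR t (f t) (deriv f t) (Pfun f t)) t := by
      have e := d (sP'.mul sQ) ht
      convert e using 1
      have o := hode t ht
      have hp : Pfun f t ≠ 0 := fun h => by simpa [h] using (key t ht).2
      have hr := rne t ht
      rw [qe t ht] at o
      rw [← o]
      change _ = deriv (fun τ => deriv (Pfun f) τ * Qfun f τ) t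
      field_simp
    have e : VV c (t, f t, deriv f t, Pfun f t, deriv (Pfun f) t * Qfun f t) =
        (1, deriv f t, deriv (deriv f) t, deriv (Pfun f) t,
          -c * Pfun f t * RR t (f t) (deriv f t) (Pfun f t)) := by
      have hr := rne t ht
      simp only [VV]
      rw [f2 t ht, qe t ht, inv_mul_cancel_right₀ hr]
    rw [e]
    exact (hasDerivAt_id t).prodMk ((d hsm ht).prodMk ((d s1 ht).prodMk ((d sP ht).prodMk q')))

lemma backward {c ε : ℝ} {a₀ a₁ a₂ a₃ : ℝ} {α : ℝ → E5} (hε : 0 < ε)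
    (h₁ : a₁ ≠ 0) (h₂ : 0 < 2 * a₀ * a₂ - a₁ ^ 2 + 4 * a₀ ^ 2)
    (hα0 : α 0 = V0 a₀ a₁ a₂ a₃)
    (hα : ∀ t ∈ Ioo (-ε) ε, HasDerivAt α (VV c (α t)) t)
    (ht1 : ∀ t ∈ Ioo (-ε) ε, (α t).1 = t)
    (hx : ∀ t ∈ Ioo (-ε) ε, 0 < (α t).2.1)
    (hz : ∀ t ∈ Ioo (-ε) ε, (α t).2.2.2.1 * SS t (α t).2.1 (α t).2.2.1 < 0) :
    IsCurvatureSolution c ε (fun t => (α t).2.1) ∧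
      HasInitialValues (fun t => (α t).2.1) a₀ a₁ a₂ a₃ := by
  have ho : IsOpen (Ioo (-ε) ε) := isOpen_Ioo
  have h0 : (0 : ℝ) ∈ Ioo (-ε) ε := ⟨by linarith, hε⟩
  have sm := smooth_curve ho (contDiffOn_VV c) hα hx
  set f : ℝ → ℝ := fun t => (α t).2.1 with hfdef
  set g : ℝ → ℝ := fun t => (α t).2.2.1 with hgdef
  set p : ℝ → ℝ := fun t => (α t).2.2.2.1 with hpdef
  set q : ℝ → ℝ := fun t => (α t).2.2.2.2 with hqdef
  have dcomp : ∀ t ∈ Ioo (-ε) ε, HasDerivAt f (g t) t ∧ HasDerivAt g (GG t (f t) (g t) (p t)) t ∧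
      HasDerivAt p (q t * RR t (f t) (g t) (p t)) t ∧
      HasDerivAt q (-c * p t * RR t (f t) (g t) (p t)) t := by
    intro t ht
    have h := hα t ht
    have e : VV c (α t) = (1, g t, GG t (f t) (g t) (p t), q t * RR t (f t) (g t) (p t),
      -c * p t * RR t (f t) (g t) (p t)) := by
      simp only [VV, ht1 t ht, hfdef, hgdef, hpdef, hqdef]
    rw [e] at h
    have k2 := h.snd
    have k3 := k2.snd
    have k4 := k3.snd
    exact ⟨k2.fst, k3.fst, k4.fst, k4.snd⟩
  have ev {u v : ℝ → ℝ} {t : ℝ} (ht : t ∈ Ioo (-ε) ε) (h : ∀ s ∈ Ioo (-ε) ε, u s = v s) :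
      u =ᶠ[𝓝 t] v := by
    filter_upwards [ho.mem_nhds ht] with s hs using h s hs
  have f1 : ∀ t ∈ Ioo (-ε) ε, deriv f t = g t := fun t ht => (dcomp t ht).1.deriv
  have f2 : ∀ t ∈ Ioo (-ε) ε, deriv (deriv f) t = GG t (f t) (g t) (p t) := fun t ht => by
    rw [(ev ht f1).deriv_eq]; exact (dcomp t ht).2.1.deriv
  have hz' : ∀ t ∈ Ioo (-ε) ε, p t * SS t (f t) (deriv f t) < 0 := fun t ht => by
    rw [f1 t ht]; exact hz t ht
  have hDD : ∀ t ∈ Ioo (-ε) ε,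
      Dfun f t = 8 * f t ^ 2 * p t ^ 2 * SS t (f t) (deriv f t) ^ 2 := by
    intro t ht
    have h2 : 0 < f t := hx t ht
    unfold Dfun
    rw [f2 t ht, f1 t ht]
    unfold GG
    field_simp
    ring
  have hP : ∀ t ∈ Ioo (-ε) ε, Pfun f t = p t := fun t ht => by
    rw [Pfun_eq]; exact PP_bwd (hx t ht) (hz' t ht) (hDD t ht)
  have hP' : ∀ t ∈ Ioo (-ε) ε, deriv (Pfun f) t = q t * RR t (f t) (g t) (p t) := fun t ht => by
    rw [(ev ht hP).deriv_eq]; exact (dcomp t ht).2.2.1.deriv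
  have rne : ∀ t ∈ Ioo (-ε) ε, RR t (f t) (g t) (p t) ≠ 0 := fun t ht => RR_ne (hx t ht) (hz t ht)
  have qe : ∀ t ∈ Ioo (-ε) ε, Qfun f t = (RR t (f t) (g t) (p t))⁻¹ := fun t ht => by
    rw [Q_eq (hx t ht) (hz' t ht) (hDD t ht), f1 t ht]
  have pq : ∀ t ∈ Ioo (-ε) ε, deriv (Pfun f) t * Qfun f t = q t := fun t ht => by
    rw [hP' t ht, qe t ht, mul_inv_cancel_right₀ (rne t ht)]
  have Sne : ∀ t ∈ Ioo (-ε) ε, SS t (f t) (deriv f t) ≠ 0 := fun t ht h => by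
    have := hz' t ht
    rw [h] at this
    simp at this
  have pne : ∀ t ∈ Ioo (-ε) ε, p t ≠ 0 := fun t ht h => by
    have := hz' t ht
    rw [h] at this
    simp at this
  refine ⟨⟨?_, hx, ?_, Sne, ?_⟩, ?_⟩
  · exact sm.snd.fst
  · intro t ht
    rw [hDD t ht]
    have a1 : 0 < f t := hx t ht
    have a2 := pne t ht
    have a3 := Sne t ht
    positivity
  · intro t ht
    have a1 := (ev (u := fun τ => deriv (Pfun f) τ * Qfun f τ) ht pq).deriv_eq
    rw [a1, (dcomp t ht).2.2.2.deriv, qe t ht, hP t ht]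
    have a2 := pne t ht
    have a3 := rne t ht
    field_simp
  · have b0 : f 0 = a₀ := by simp [hfdef, hα0, V0]
    have b1 : g 0 = a₁ := by simp [hgdef, hα0, V0]
    have b2 : p 0 = P0 a₀ a₁ a₂ := by simp [hpdef, hα0, V0]
    have b3 : q 0 = P1 a₀ a₁ a₂ a₃ / RR 0 a₀ a₁ (P0 a₀ a₁ a₂) := by simp [hqdef, hα0, V0]
    have h₀ : 0 < a₀ := b0 ▸ hx 0 h0
    have c2 : deriv (deriv f) 0 = a₂ := by
      have k := (PP_fwd h₀ h₁ h₂).1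
      change _ = 8 * a₀ ^ 2 * P0 a₀ a₁ a₂ ^ 2 * a₁ ^ 2 at k
      have k2 := hDD 0 h0
      rw [SS_zero, f1 0 h0, b0, b1, b2, ← k] at k2
      unfold Dfun at k2
      rw [f1 0 h0, b0, b1] at k2
      have : 2 * a₀ * deriv (deriv f) 0 = 2 * a₀ * a₂ := by linarith
      exact mul_left_cancel₀ (by positivity) this
    refine ⟨b0, (f1 0 h0).trans b1, c2, ?_⟩
    have e0 : iteratedDeriv 3 f 0 = deriv (deriv (deriv f)) 0 := by
      simp [iteratedDeriv_succ, iteratedDeriv_zero]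
    obtain ⟨d1, d2, d3, -⟩ := dcomp 0 h0
    have hr := rne 0 h0
    have hp := pne 0 h0
    rw [← f2 0 h0, c2] at d2
    rw [b0, b1, b2] at hr
    rw [b3, b0, b1, b2, div_mul_cancel₀ _ hr] at d3
    rw [b2] at hp
    rw [b1] at d1
    rw [e0, (ev h0 f2).deriv_eq, (hasDerivAt_GG d1 d2 d3 (hx 0 h0).ne').deriv, b0, b1, b2,
      GD_split, SS_zero]
    unfold P1
    field_simp
    ring

lemma time_eq {c ε : ℝ} {α : ℝ → E5} (hε : 0 < ε) (h0 : (α 0).1 = 0)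
    (hα : ∀ t ∈ Ioo (-ε) ε, HasDerivAt α (VV c (α t)) t) :
    ∀ t ∈ Ioo (-ε) ε, (α t).1 = t := by
  intro t ht
  have hd : ∀ s ∈ Ioo (-ε) ε, HasDerivAt (fun s => (α s).1 - s) 0 s := by
    intro s hs
    have k : HasDerivAt (fun s => (α s).1) 1 s := (hα s hs).fst
    exact (k.sub (hasDerivAt_id s)).congr_deriv (sub_self 1)
  have := isOpen_Ioo.is_const_of_deriv_eq_zero (isPreconnected_Ioo)
    (fun s hs => (hd s hs).differentiableAt.differentiableWithinAt)
    (fun s hs => (hd s hs).deriv) ht (show (0 : ℝ) ∈ Ioo (-ε) ε from ⟨by linarith, hε⟩)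
  simp only [h0] at this
  linarith

end CurvODE

open CurvODE
theorem constant_curvature_ode_existence_uniqueness
    (c : ℝ) (a₀ a₁ a₂ a₃ : ℝ) (h₀ : 0 < a₀) (h₁ : a₁ ≠ 0)
    (h₂ : 0 < 2 * a₀ * a₂ - a₁ ^ 2 + 4 * a₀ ^ 2) :
    (∃ ε > 0, ∃ f : ℝ → ℝ, IsCurvatureSolution c ε f ∧ HasInitialValues f a₀ a₁ a₂ a₃) ∧
    (∀ ε₁ > 0, ∀ ε₂ > 0, ∀ f₁ f₂ : ℝ → ℝ,
      IsCurvatureSolution c ε₁ f₁ → HasInitialValues f₁ a₀ a₁ a₂ a₃ →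
      IsCurvatureSolution c ε₂ f₂ → HasInitialValues f₂ a₀ a₁ a₂ a₃ →
      ∃ δ > 0, ∀ t ∈ Ioo (-δ) δ, f₁ t = f₂ t) := by
  have hV : ContDiffAt ℝ (⊤ : ℕ∞) (VV c) (V0 a₀ a₁ a₂ a₃) :=
    (contDiffOn_VV c).contDiffAt (isOpen_dom.mem_nhds h₀)
  have hV1 : ContDiffAt ℝ 1 (VV c) (V0 a₀ a₁ a₂ a₃) := hV.of_le (by exact_mod_cast le_top)
  constructor
  · obtain ⟨α, hα0, ε, hε, hα⟩ :=
      hV1.exists_forall_mem_closedBall_exists_eq_forall_mem_Ioo_hasDerivAt₀ 0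
    simp only [zero_sub, zero_add] at hα
    have h0 : (0 : ℝ) ∈ Ioo (-ε) ε := ⟨by linarith, hε⟩
    have hc : ContinuousAt α 0 := (hα 0 h0).continuousAt
    have hz0 : P0 a₀ a₁ a₂ * a₁ < 0 := (PP_fwd h₀ h₁ h₂).2
    have ev1 : ∀ᶠ t in 𝓝 (0 : ℝ), 0 < (α t).2.1 := by
      have : ContinuousAt (fun t => (α t).2.1) 0 := by fun_prop
      refine this.eventually_const_lt ?_
      beta_reduce
      rw [hα0]; exact h₀
    have ev2 : ∀ᶠ t in 𝓝 (0 : ℝ), (α t).2.2.2.1 * SS t (α t).2.1 (α t).2.2.1 < 0 := by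
      have : ContinuousAt (fun t => (α t).2.2.2.1 * SS t (α t).2.1 (α t).2.2.1) 0 := by
        unfold SS
        fun_prop
      refine this.eventually_lt_const ?_
      beta_reduce
      rw [hα0, SS_zero]; exact hz0
    obtain ⟨δ, hδ, hb⟩ := Metric.eventually_nhds_iff_ball.1 (ev1.and ev2)
    rw [Real.ball_eq_Ioo] at hb
    simp only [zero_sub, zero_add] at hb
    have hs1 : Ioo (-(min ε δ)) (min ε δ) ⊆ Ioo (-ε) ε :=
      Ioo_subset_Ioo (neg_le_neg (min_le_left _ _)) (min_le_left _ _)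
    have hs2 : Ioo (-(min ε δ)) (min ε δ) ⊆ Ioo (-δ) δ :=
      Ioo_subset_Ioo (neg_le_neg (min_le_right _ _)) (min_le_right _ _)
    refine ⟨min ε δ, lt_min hε hδ, fun t => (α t).2.1, ?_⟩
    exact backward (lt_min hε hδ) h₁ h₂ hα0 (fun t ht => hα t (hs1 ht))
      (fun t ht => time_eq hε (by rw [hα0]; rfl) hα t (hs1 ht))
      (fun t ht => (hb t (hs2 ht)).1) (fun t ht => (hb t (hs2 ht)).2)
  · intro ε₁ hε₁ ε₂ hε₂ f₁ f₂ hf₁ hi₁ hf₂ hi₂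
    obtain ⟨α, hαf, hα0, hα⟩ := forward hε₁ hf₁ hi₁
    obtain ⟨β, hβf, hβ0, hβ⟩ := forward hε₂ hf₂ hi₂
    obtain ⟨K, s, hs, hL⟩ := hV1.exists_lipschitzOnWith
    have aux : ∀ {ε : ℝ} {γ : ℝ → E5}, 0 < ε → γ 0 = V0 a₀ a₁ a₂ a₃ →
        (∀ t ∈ Ioo (-ε) ε, HasDerivAt γ (VV c (γ t)) t) →
        ∀ᶠ t in 𝓝 (0 : ℝ), HasDerivAt γ (VV c (γ t)) t ∧ γ t ∈ s := by
      intro ε γ hε h0 h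
      have m : (0 : ℝ) ∈ Ioo (-ε) ε := ⟨by linarith, hε⟩
      have hc : ContinuousAt γ 0 := (h 0 m).continuousAt
      have h2 := hc.eventually_mem (by rw [h0]; exact hs)
      filter_upwards [isOpen_Ioo.mem_nhds m, h2] with t h1 h2 using ⟨h t h1, h2⟩
    have := ODE_solution_unique_of_eventually (v := fun _ => VV c) (s := fun _ => s)
      (Eventually.of_forall fun _ => hL) (aux hε₁ hα0 hα) (aux hε₂ hβ0 hβ) (hα0.trans hβ0.symm)
    obtain ⟨δ, hδ, hb⟩ := Metric.eventually_nhds_iff_ball.1 this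
    rw [Real.ball_eq_Ioo] at hb
    simp only [zero_sub, zero_add] at hb
    exact ⟨δ, hδ, fun t ht => by rw [← hαf, ← hβf, hb t ht]⟩
end

section
/- Let ε > 0 and let f : (−ε, ε) → ℝ be smooth with f > 0, f'(0) ≠ 0 and D(t) = 2f(t)f''(t) − f'(t)² + 4f(t)² > 0 on (−ε, ε), and suppose the function t ↦ 2f(t)²·(4f'(t) + f'''(t))·D(t)^{−3/2} is constant on (−ε, ε). Then there exist δ ∈ (0, ε] and real numbers a, b, c, d with a·c ≠ 0 and ad − bc > 0 such that for all |t| < δ: (a·cos t + b·sin t)·(2f(t)·cos t − f'(t)·sin t) + (c·cos t + d·sin t)·(2f(t)·sin t + f'(t)·cos t) = 0. -/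
open Real Set

/-- A function with zero derivative on the interval equals its value at `0`. -/
lemma const_of_deriv_zero (ε : ℝ) (hε : 0 < ε) (g : ℝ → ℝ)
    (h : ∀ t ∈ Ioo (-ε) ε, HasDerivAt g 0 t) : ∀ t ∈ Ioo (-ε) ε, g t = g 0 := by
  intro t ht
  refine isOpen_Ioo.is_const_of_deriv_eq_zero isPreconnected_Ioo
    (fun x hx => (h x hx).differentiableAt.differentiableWithinAt)
    (fun x hx => (h x hx).deriv) ht ⟨by linarith, hε⟩

theorem landsberg_implies_berwald_ode
    (ε : ℝ) (hε : 0 < ε) (f : ℝ → ℝ)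
    (hf : ContDiffOn ℝ (⊤ : ℕ∞) f (Ioo (-ε) ε))
    (hfpos : ∀ t ∈ Ioo (-ε) ε, 0 < f t)
    (hf'0 : deriv f 0 ≠ 0)
    (hD : ∀ t ∈ Ioo (-ε) ε, 0 < Dfun f t)
    (hLandsberg : ∃ k : ℝ, ∀ t ∈ Ioo (-ε) ε,
      2 * (f t) ^ 2 * (4 * deriv f t + iteratedDeriv 3 f t) * (Dfun f t) ^ (-(3 : ℝ) / 2) = k) :
    ∃ δ ∈ Ioc 0 ε, ∃ a b c d : ℝ, a * c ≠ 0 ∧ 0 < a * d - b * c ∧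
      ∀ t : ℝ, |t| < δ →
        (a * Real.cos t + b * Real.sin t) * (2 * f t * Real.cos t - deriv f t * Real.sin t) +
          (c * Real.cos t + d * Real.sin t) * (2 * f t * Real.sin t + deriv f t * Real.cos t)
          = 0 := by
  obtain ⟨k, hk⟩ := hLandsberg
  have hf1 : ContDiffOn ℝ (⊤ : ℕ∞) (deriv f) (Ioo (-ε) ε) :=
    hf.deriv_of_isOpen isOpen_Ioo (by simp)
  have hf2 : ContDiffOn ℝ (⊤ : ℕ∞) (deriv (deriv f)) (Ioo (-ε) ε) :=
    hf1.deriv_of_isOpen isOpen_Ioo (by simp)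
  have key : ∀ g : ℝ → ℝ, ContDiffOn ℝ (⊤ : ℕ∞) g (Ioo (-ε) ε) →
      ∀ t ∈ Ioo (-ε) ε, HasDerivAt g (deriv g t) t := by
    intro g hg t ht
    exact ((hg.contDiffAt (isOpen_Ioo.mem_nhds ht)).differentiableAt (by simp)).hasDerivAt
  have d0 := key f hf
  have d1 := key _ hf1
  have d2 := key _ hf2
  have h3 : iteratedDeriv 3 f = deriv (deriv (deriv f)) := by
    simp [iteratedDeriv_succ, iteratedDeriv_zero]
  rw [h3] at hk
  have h0 : (0 : ℝ) ∈ Ioo (-ε) ε := ⟨by linarith, hε⟩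
  have dD : ∀ t ∈ Ioo (-ε) ε, HasDerivAt (Dfun f)
      (2 * f t * (4 * deriv f t + deriv (deriv (deriv f)) t)) t := by
    intro t ht
    have := ((((d0 t ht).const_mul 2).mul (d2 t ht)).sub ((d1 t ht).pow 2)).add
      (((d0 t ht).pow 2).const_mul 4)
    refine HasDerivAt.congr_deriv (f := Dfun f) this ?_
    simp
    ring
  obtain ⟨S, hS⟩ : ∃ S : ℝ → ℝ, S = fun t => (Dfun f t) ^ (-(1 : ℝ) / 2) := ⟨_, rfl⟩
  have Spos : ∀ t ∈ Ioo (-ε) ε, 0 < S t := by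
    intro t ht
    rw [hS]
    exact Real.rpow_pos_of_pos (hD t ht) _
  have S2 : ∀ t ∈ Ioo (-ε) ε, S t ^ 2 * Dfun f t = 1 := by
    intro t ht
    have hp := hD t ht
    rw [hS]
    simp only
    rw [← Real.rpow_natCast, ← Real.rpow_mul hp.le]
    norm_num
    rw [Real.rpow_neg_one]
    exact inv_mul_cancel₀ hp.ne'
  have dS : ∀ t ∈ Ioo (-ε) ε, HasDerivAt S (-k / (2 * f t)) t := by
    intro t ht
    have hp := hD t ht
    have hfp := hfpos t ht
    have := (dD t ht).rpow_const (p := -(1 : ℝ) / 2) (Or.inl hp.ne')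
    rw [hS]
    refine this.congr_deriv ?_
    rw [← hk t ht]
    have : (-(1 : ℝ) / 2 - 1) = -3 / 2 := by norm_num
    rw [this]
    field_simp
  obtain ⟨p, hpd⟩ : ∃ p : ℝ → ℝ, p = fun t => - deriv f t * S t := ⟨_, rfl⟩
  obtain ⟨q, hqd⟩ : ∃ q : ℝ → ℝ, q = fun t => 2 * f t * S t := ⟨_, rfl⟩
  obtain ⟨β, hβd⟩ : ∃ β : ℝ → ℝ, β = fun t => (-k * p t - p t ^ 2 - 1) / q t := ⟨_, rfl⟩
  have qpos : ∀ t ∈ Ioo (-ε) ε, 0 < q t := by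
    intro t ht
    have := hfpos t ht
    have := Spos t ht
    rw [hqd]
    positivity
  have qβ : ∀ t ∈ Ioo (-ε) ε, β t * q t = -k * p t - p t ^ 2 - 1 := by
    intro t ht
    rw [hβd]
    exact div_mul_cancel₀ _ (qpos t ht).ne'
  have dq : ∀ t ∈ Ioo (-ε) ε, HasDerivAt q (-2 * p t - k) t := by
    intro t ht
    have hfp := hfpos t ht
    have := ((d0 t ht).const_mul 2).mul (dS t ht)
    rw [hqd]
    refine this.congr_deriv ?_
    rw [hpd]
    field_simp
    ring
  have dp : ∀ t ∈ Ioo (-ε) ε, HasDerivAt p (β t + q t) t := by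
    intro t ht
    have hfp := hfpos t ht
    have hSp := Spos t ht
    have := (d1 t ht).neg.mul (dS t ht)
    have h2 := S2 t ht
    rw [hpd]
    refine this.congr_deriv ?_
    apply mul_right_cancel₀ (qpos t ht).ne'
    rw [add_mul (β t), qβ t ht, hpd, hqd]
    unfold Dfun at h2
    simp only [Pi.neg_apply]
    field_simp
    linear_combination -h2
  have dβ : ∀ t ∈ Ioo (-ε) ε, HasDerivAt β (-2 * p t - k) t := by
    intro t ht
    have hq := qpos t ht
    have := ((((dp t ht).const_mul (-k)).sub ((dp t ht).pow 2)).sub_const 1).div (dq t ht) hq.ne'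
    have e := qβ t ht
    rw [hβd]
    refine this.congr_deriv ?_
    rw [div_eq_iff (by positivity)]
    simp
    linear_combination (-2 * p t - k) * e
  have hm := const_of_deriv_zero ε hε (fun t => β t - q t)
    (fun t ht => ((dβ t ht).sub (dq t ht)).congr_deriv (by ring))
  obtain ⟨m, hmd⟩ : ∃ m, m = β 0 - q 0 := ⟨_, rfl⟩
  rw [← hmd] at hm
  have dc : ∀ t : ℝ, HasDerivAt (fun t => cos (2 * t)) (-sin (2 * t) * 2) t := by
    intro t
    simpa using ((hasDerivAt_id t).const_mul 2).cos
  have ds : ∀ t : ℝ, HasDerivAt (fun t => sin (2 * t)) (cos (2 * t) * 2) t := by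
    intro t
    simpa using ((hasDerivAt_id t).const_mul 2).sin
  have hX := const_of_deriv_zero ε hε
    (fun t => (p t + k / 2) * cos (2 * t) - (q t + m / 2) * sin (2 * t))
    (fun t ht => ((((dp t ht).add_const (k / 2)).mul (dc t)).sub
      (((dq t ht).add_const (m / 2)).mul (ds t))).congr_deriv
        (by linear_combination cos (2 * t) * hm t ht))
  have hY := const_of_deriv_zero ε hε
    (fun t => (p t + k / 2) * sin (2 * t) + (q t + m / 2) * cos (2 * t))
    (fun t ht => ((((dp t ht).add_const (k / 2)).mul (ds t)).add
      (((dq t ht).add_const (m / 2)).mul (dc t))).congr_deriv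
        (by linear_combination sin (2 * t) * hm t ht))
  simp only [mul_zero, cos_zero, sin_zero, mul_one, sub_zero, zero_add] at hX hY
  have hq0 := qpos 0 h0
  have hp0 : p 0 ≠ 0 := by
    rw [hpd]
    exact mul_ne_zero (neg_ne_zero.mpr hf'0) (Spos 0 h0).ne'
  refine ⟨ε, ⟨hε, le_rfl⟩, p 0, β 0, q 0, -k - p 0, mul_ne_zero hp0 hq0.ne', ?_, ?_⟩
  · linarith [qβ 0 h0]
  · intro t ht
    have ht' : t ∈ Ioo (-ε) ε := abs_lt.mp ht
    have X := hX t ht'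
    have Y := hY t ht'
    rw [cos_two_mul, sin_two_mul] at X Y
    have cs := sin_sq_add_cos_sq t
    have P : p 0 * cos t + β 0 * sin t = p t * cos t - q t * sin t := by
      linear_combination -cos t * X - sin t * Y - sin t * hmd + (2 * cos t * (p t + k / 2)) * cs
    have Q : q 0 * cos t + (-k - p 0) * sin t = p t * sin t + q t * cos t := by
      linear_combination sin t * X - cos t * Y + (2 * cos t * (q t + m / 2)) * cs
    rw [P, Q, hpd, hqd]
    ring
end

section
/- For every (a, b, c, d) ∈ ℝ⁴ with a·c ≠ 0 and ad − bc > 0, there exist ε > 0 and a smooth function f : (−ε, ε) → ℝ with f > 0, f'(0) ≠ 0 and D(t) = 2f(t)f''(t) − f'(t)² + 4f(t)² > 0 on (−ε, ε), such that for all |t| < ε: (a·cos t + b·sin t)·(2f(t)·cos t − f'(t)·sin t) + (c·cos t + d·sin t)·(2f(t)·sin t + f'(t)·cos t) = 0. -/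
open Real Set

theorem berwald_metric_existence
    (a b c d : ℝ) (hac : a * c ≠ 0) (hdet : 0 < a * d - b * c) :
    ∃ ε > 0, ∃ f : ℝ → ℝ,
      ContDiffOn ℝ (⊤ : ℕ∞) f (Ioo (-ε) ε) ∧
      (∀ t ∈ Ioo (-ε) ε, 0 < f t) ∧
      deriv f 0 ≠ 0 ∧
      (∀ t ∈ Ioo (-ε) ε, 0 < Dfun f t) ∧
      ∀ t : ℝ, |t| < ε →
        (a * Real.cos t + b * Real.sin t) * (2 * f t * Real.cos t - deriv f t * Real.sin t) +
          (c * Real.cos t + d * Real.sin t) * (2 * f t * Real.sin t + deriv f t * Real.cos t)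
          = 0 := by
  have ha : a ≠ 0 := left_ne_zero_of_mul hac
  have hc : c ≠ 0 := right_ne_zero_of_mul hac
  obtain ⟨P, hP⟩ : ∃ P : ℝ → ℝ, P = fun t => (a * cos t + b * sin t) * cos t
    + (c * cos t + d * sin t) * sin t := ⟨_, rfl⟩
  obtain ⟨Q, hQ⟩ : ∃ Q : ℝ → ℝ, Q = fun t => (c * cos t + d * sin t) * cos t
    - (a * cos t + b * sin t) * sin t := ⟨_, rfl⟩
  have hPc : ContDiff ℝ (⊤ : ℕ∞) P := by rw [hP]; fun_prop
  have hQc : ContDiff ℝ (⊤ : ℕ∞) Q := by rw [hQ]; fun_prop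
  have hQ0 : Q 0 ≠ 0 := by simp [hQ, hc]
  have hev : ∀ᶠ t in nhds (0:ℝ), Q t ≠ 0 := hQc.continuous.continuousAt.eventually_ne hQ0
  obtain ⟨ε, hε, hball⟩ := Metric.eventually_nhds_iff_ball.1 hev
  rw [Real.ball_eq_Ioo, zero_sub, zero_add] at hball
  have hlin : ∀ (p q : ℝ) (t : ℝ), HasDerivAt (fun t => p * cos t + q * sin t)
      (q * cos t - p * sin t) t := by
    intro p q t
    have := ((hasDerivAt_cos t).const_mul p).add ((hasDerivAt_sin t).const_mul q)
    exact this.congr_deriv (by ring)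
  have hP' : ∀ t, HasDerivAt P _ t := fun t => by
    rw [hP]
    exact ((hlin a b t).mul (hasDerivAt_cos t)).add ((hlin c d t).mul (hasDerivAt_sin t))
  have hQ' : ∀ t, HasDerivAt Q _ t := fun t => by
    rw [hQ]
    exact ((hlin c d t).mul (hasDerivAt_cos t)).sub ((hlin a b t).mul (hasDerivAt_sin t))
  obtain ⟨g, hg⟩ : ∃ g : ℝ → ℝ, g = fun t => (-2 * P t) / Q t := ⟨_, rfl⟩
  have hgc : ContDiffOn ℝ (⊤ : ℕ∞) g (Ioo (-ε) ε) := by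
    rw [hg]
    exact (contDiff_const.mul hPc).contDiffOn.div hQc.contDiffOn hball
  have h0 : (0:ℝ) ∈ Ioo (-ε) ε := ⟨by linarith, hε⟩
  obtain ⟨F, hF⟩ : ∃ F : ℝ → ℝ, F = fun t => ∫ x in (0:ℝ)..t, g x := ⟨_, rfl⟩
  have hF' : ∀ t ∈ Ioo (-ε) ε, HasDerivAt F (g t) t := by
    intro t ht
    rw [hF]
    have hsub : uIcc 0 t ⊆ Ioo (-ε) ε := (ordConnected_Ioo).uIcc_subset h0 ht
    exact intervalIntegral.integral_hasDerivAt_right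
      (hgc.continuousOn.mono hsub).intervalIntegrable
      (hgc.continuousOn.stronglyMeasurableAtFilter isOpen_Ioo t ht)
      (hgc.continuousOn.continuousAt (isOpen_Ioo.mem_nhds ht))
  have hFc : ContDiffOn ℝ (⊤ : ℕ∞) F (Ioo (-ε) ε) := by
    rw [contDiffOn_infty_iff_deriv_of_isOpen isOpen_Ioo]
    exact ⟨fun t ht => (hF' t ht).differentiableAt.differentiableWithinAt,
      hgc.congr fun t ht => (hF' t ht).deriv⟩
  have hf' : ∀ t ∈ Ioo (-ε) ε, HasDerivAt (fun t => exp (F t)) (exp (F t) * g t) t :=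
    fun t ht => (hF' t ht).exp
  refine ⟨ε, hε, fun t => exp (F t), hFc.exp, fun t _ => exp_pos _, ?_, ?_, ?_⟩
  · rw [(hf' 0 h0).deriv]
    simp [hg, hP, hQ, ha, hc]
  · intro t ht
    have hQt := hball t ht
    have hg' := ((hP' t).const_mul (-2)).fun_div (hQ' t) hQt
    rw [← hg] at hg'
    have hdd := ((hf' t ht).fun_mul hg').deriv
    have he : deriv (fun t => exp (F t)) =ᶠ[nhds t] fun t => exp (F t) * g t := by
      filter_upwards [isOpen_Ioo.mem_nhds ht] with s hs using (hf' s hs).deriv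
    rw [← he.deriv_eq] at hdd
    have key : Dfun (fun t => exp (F t)) t = exp (F t) ^ 2 * (4 * (a * d - b * c) / Q t ^ 2) := by
      unfold Dfun
      rw [hdd, (hf' t ht).deriv]
      have hgt : g t = -2 * P t / Q t := by rw [hg]
      rw [hgt]
      field_simp
      have hs : sin t ^ 2 = 1 - cos t ^ 2 := by rw [← sin_sq_add_cos_sq t]; ring
      rw [hP, hQ]
      have hs4 : a * d - b * c = (a * d - b * c) * (sin t ^ 2 + cos t ^ 2) ^ 2 := by
        rw [sin_sq_add_cos_sq]; ring
      try rw [hs4]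
      ring
    rw [key]
    have : 0 < Q t ^ 2 := by positivity
    positivity
  · intro t ht
    have ht' : t ∈ Ioo (-ε) ε := abs_lt.1 ht
    rw [(hf' t ht').deriv]
    have hgQ : g t * Q t = -2 * P t := by rw [hg]; exact div_mul_cancel₀ _ (hball t ht')
    rw [hP, hQ] at hgQ
    simp only at hgQ
    linear_combination exp (F t) * hgQ
end

section
/- Let ε ∈ (0, π/2) and let f : (−ε, ε) → ℝ be smooth with f > 0, f'(0) ≠ 0 and D(t) = 2f(t)f''(t) − f'(t)² + 4f(t)² > 0 on (−ε, ε). Suppose (a, b, c, d) ∈ ℝ⁴ is nonzero and (a·cos t + b·sin t)·(2f(t)·cos t − f'(t)·sin t) + (c·cos t + d·sin t)·(2f(t)·sin t + f'(t)·cos t) = 0 for all |t| < ε. Then a ≠ 0, c ≠ 0 and ad − bc > 0. -/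
open Real Set

theorem berwald_coefficients_necessity
    (ε : ℝ) (hε : ε ∈ Ioo 0 (π / 2)) (f : ℝ → ℝ)
    (hf : ContDiffOn ℝ (⊤ : ℕ∞) f (Ioo (-ε) ε))
    (hfpos : ∀ t ∈ Ioo (-ε) ε, 0 < f t)
    (hf'0 : deriv f 0 ≠ 0)
    (hD : ∀ t ∈ Ioo (-ε) ε, 0 < Dfun f t)
    (a b c d : ℝ) (habcd : ¬(a = 0 ∧ b = 0 ∧ c = 0 ∧ d = 0))
    (heq : ∀ t : ℝ, |t| < ε →
      (a * Real.cos t + b * Real.sin t) * (2 * f t * Real.cos t - deriv f t * Real.sin t) +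
        (c * Real.cos t + d * Real.sin t) * (2 * f t * Real.sin t + deriv f t * Real.cos t)
        = 0) :
    a ≠ 0 ∧ c ≠ 0 ∧ 0 < a * d - b * c := by
  have hopen : IsOpen (Ioo (-ε) ε) := isOpen_Ioo
  have hε0 : 0 < ε := hε.1
  have key : ∀ t ∈ Ioo (-ε) ε,
      (-a * Real.sin t + b * Real.cos t) * (2 * f t * Real.cos t - deriv f t * Real.sin t) +
      (a * Real.cos t + b * Real.sin t) *
        (deriv f t * Real.cos t - (2 * f t + deriv (deriv f) t) * Real.sin t) +
      ((-c * Real.sin t + d * Real.cos t) * (2 * f t * Real.sin t + deriv f t * Real.cos t) +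
      (c * Real.cos t + d * Real.sin t) *
        (deriv f t * Real.sin t + (2 * f t + deriv (deriv f) t) * Real.cos t)) = 0 := by
    intro t ht
    have h1 : HasDerivAt f (deriv f t) t :=
      ((hf.contDiffAt (hopen.mem_nhds ht)).differentiableAt (by simp)).hasDerivAt
    have hf2 : ContDiffOn ℝ 1 (deriv f) (Ioo (-ε) ε) :=
      hf.deriv_of_isOpen hopen (by norm_cast)
    have h2 : HasDerivAt (deriv f) (deriv (deriv f) t) t :=
      ((hf2.contDiffAt (hopen.mem_nhds ht)).differentiableAt (by simp)).hasDerivAt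
    have hs := Real.hasDerivAt_sin t
    have hc := Real.hasDerivAt_cos t
    have hu := ((h1.const_mul 2).mul hc).sub (h2.mul hs)
    have hv := ((h1.const_mul 2).mul hs).add (h2.mul hc)
    have hp := (hc.const_mul a).add (hs.const_mul b)
    have hq := (hc.const_mul c).add (hs.const_mul d)
    have hall := (hp.mul hu).add (hq.mul hv)
    have hz : HasDerivAt (fun _ : ℝ => (0 : ℝ)) 0 t := hasDerivAt_const t 0
    have hz' := hz.congr_of_eventuallyEq (f₁ := _) (by
      filter_upwards [hopen.mem_nhds ht] with x hx
      exact heq x (abs_lt.2 hx))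
    have := hall.unique hz'
    simp only [Pi.add_apply, Pi.sub_apply, Pi.mul_apply] at this
    linear_combination this
  have h0 : (0 : ℝ) ∈ Ioo (-ε) ε := ⟨by linarith, hε0⟩
  have e0 := heq 0 (by simpa using hε0)
  have k0 := key 0 h0
  have d0 := hD 0 h0
  have f0 := hfpos 0 h0
  simp only [Dfun, Real.sin_zero, Real.cos_zero] at e0 k0 d0
  have hc : c ≠ 0 := by
    intro hc
    have ha : a = 0 := by
      subst hc
      have : f 0 * a = 0 := by linarith
      exact (mul_eq_zero.1 this).resolve_left f0.ne'
    subst hc ha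
    have ht : ε / 2 ∈ Ioo (-ε) ε := ⟨by linarith, by linarith⟩
    have e1 := heq (ε / 2) (abs_lt.2 ht)
    have k1 := key _ ht
    have d1 := hD _ ht
    have hs : Real.sin (ε / 2) ≠ 0 :=
      (Real.sin_pos_of_pos_of_lt_pi (by linarith) (by linarith [hε.2, Real.pi_pos])).ne'
    have hsc := Real.sin_sq_add_cos_sq (ε / 2)
    unfold Dfun at d1
    generalize Real.sin (ε / 2) = s at *
    generalize Real.cos (ε / 2) = k at *
    generalize f (ε / 2) = F at *
    generalize deriv (deriv f) (ε / 2) = F2 at *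
    generalize deriv f (ε / 2) = F1 at *
    obtain ⟨u, hu⟩ : ∃ u, u = 2 * F * k - F1 * s := ⟨_, rfl⟩
    obtain ⟨v, hv⟩ : ∃ v, v = 2 * F * s + F1 * k := ⟨_, rfl⟩
    obtain ⟨u', hu'⟩ : ∃ u', u' = F1 * k - (2 * F + F2) * s := ⟨_, rfl⟩
    obtain ⟨v', hv'⟩ : ∃ v', v' = F1 * s + (2 * F + F2) * k := ⟨_, rfl⟩
    have hdet : u * v' - v * u' = 2 * F * F2 - F1 ^ 2 + 4 * F ^ 2 := by
      rw [hu, hv, hu', hv']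
      linear_combination (2 * F * F2 - F1 ^ 2 + 4 * F ^ 2) * hsc
    rw [← hdet] at d1
    rw [← hu, ← hv] at e1
    rw [← hu, ← hv, ← hu', ← hv'] at k1
    have A : b * u + d * v = 0 := by
      apply (mul_eq_zero.1 (_ : s * (b * u + d * v) = 0)).resolve_left hs
      linear_combination e1
    have B : b * u' + d * v' = 0 := by
      apply (mul_eq_zero.1 (_ : s * (b * u' + d * v') = 0)).resolve_left hs
      linear_combination k1 - k * A
    apply habcd
    refine ⟨rfl, ?_, rfl, ?_⟩
    · apply (mul_eq_zero.1 (_ : (u * v' - v * u') * b = 0)).resolve_left d1.ne'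
      linear_combination v' * A - v * B
    · apply (mul_eq_zero.1 (_ : (u * v' - v * u') * d = 0)).resolve_left d1.ne'
      linear_combination u * B - u' * A
  have ha : a ≠ 0 := by
    intro ha
    subst ha
    have : c * deriv f 0 = 0 := by linarith
    exact (mul_ne_zero hc hf'0) this
  refine ⟨ha, hc, ?_⟩
  generalize f 0 = F at *
  generalize deriv (deriv f) 0 = F2 at *
  generalize deriv f 0 = F1 at *
  have hF : 0 < 4 * F ^ 2 := by positivity
  have hc2 : 0 < c ^ 2 := by positivity
  have : 4 * F ^ 2 * (a * d - b * c) = c ^ 2 * (2 * F * F2 - F1 ^ 2 + 4 * F ^ 2) := by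
    linear_combination (2 * F * d + c * F1) * e0 - 2 * F * c * k0
  have h3 : 0 < 4 * F ^ 2 * (a * d - b * c) := by rw [this]; positivity
  exact (pos_iff_pos_of_mul_pos h3).1 hF
end

section
/- Let λ ∈ ℝ, μ > 0, ε₁, ε₂ ∈ ℝ. On the cone {(y¹,y²) ∈ ℝ² : y¹ > 0}, let E(y¹,y²) = ((y¹)² + (y²)²)·f(arctan(y²/y¹)) with f(t) = μ·e^{−2λt}, let g_y be the Hessian bilinear form of E at y, and equip ℝ² with the Lie bracket [u,v] = (u¹v² − u²v¹)·(ε₁, ε₂). Then the quadratic map η(y) = −[(ε₁y¹ + ε₂y²) + λ·(−ε₂y¹ + ε₁y²)]/(λ² + 1) · (λy¹ − y², y¹ + λy²) satisfies g_y(η(y), u) = g_y(y, [u, y]) for every y in the cone and every u ∈ ℝ², i.e. the spray vector field of the conic Finsler metric F = √(2E) is quadratic. -/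
open Real Set

/-- The 2-dimensional Lie bracket determined by `[e₁,e₂] = ε₁e₁ + ε₂e₂`. -/
def bracket (ε₁ ε₂ : ℝ) (u v : ℝ × ℝ) : ℝ × ℝ :=
  (u.1 * v.2 - u.2 * v.1) • ((ε₁, ε₂) : ℝ × ℝ)

/-- The angular factor of the energy. -/
noncomputable def angW (lam μ : ℝ) (y : ℝ × ℝ) : ℝ :=
  μ * Real.exp (-2 * lam * Real.arctan (y.2 / y.1))

lemma hasFDerivAt_angW (lam μ : ℝ) (y : ℝ × ℝ) (hy : 0 < y.1) :
    HasFDerivAt (angW lam μ)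
      ((-2 * lam * angW lam μ y / (y.1 ^ 2 + y.2 ^ 2)) •
        ((-y.2) • ContinuousLinearMap.fst ℝ ℝ ℝ + y.1 • ContinuousLinearMap.snd ℝ ℝ ℝ)) y := by
  have h1 : HasFDerivAt (fun y : ℝ × ℝ => y.1) (ContinuousLinearMap.fst ℝ ℝ ℝ) y := hasFDerivAt_fst
  have h2 : HasFDerivAt (fun y : ℝ × ℝ => y.2) (ContinuousLinearMap.snd ℝ ℝ ℝ) y := hasFDerivAt_snd
  have hi := (hasDerivAt_inv hy.ne').comp_hasFDerivAt y h1
  have hq := h2.mul hi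
  have h := (((hq.arctan).const_mul (-2 * lam)).exp).const_mul μ
  have hr : y.1 ^ 2 + y.2 ^ 2 ≠ 0 := by positivity
  have hr2 : 1 + (y.2 / y.1) ^ 2 ≠ 0 := by positivity
  have hy' := hy.ne'
  refine (h.congr_fderiv ?_).congr_of_eventuallyEq ?_
  · ext <;>
    · simp [angW, ← div_eq_mul_inv]
      field_simp
      try ring
  · exact Filter.Eventually.of_forall fun z => by simp [angW, div_eq_mul_inv]

/-- The differential of the energy. -/
noncomputable def dEn (lam μ : ℝ) (y : ℝ × ℝ) : ℝ × ℝ →L[ℝ] ℝ :=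
  (2 * angW lam μ y) • ((y.1 + lam * y.2) • ContinuousLinearMap.fst ℝ ℝ ℝ
    + (y.2 - lam * y.1) • ContinuousLinearMap.snd ℝ ℝ ℝ)

lemma hasFDerivAt_energy_s15 (lam μ : ℝ) (y : ℝ × ℝ) (hy : 0 < y.1) :
    HasFDerivAt (fun y : ℝ × ℝ => (y.1 ^ 2 + y.2 ^ 2) * angW lam μ y) (dEn lam μ y) y := by
  have h1 : HasFDerivAt (fun y : ℝ × ℝ => y.1) (ContinuousLinearMap.fst ℝ ℝ ℝ) y := hasFDerivAt_fst
  have h2 : HasFDerivAt (fun y : ℝ × ℝ => y.2) (ContinuousLinearMap.snd ℝ ℝ ℝ) y := hasFDerivAt_snd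
  have h := ((h1.pow 2).add (h2.pow 2)).mul (hasFDerivAt_angW lam μ y hy)
  have hr : y.1 ^ 2 + y.2 ^ 2 ≠ 0 := by positivity
  refine h.congr_fderiv ?_
  ext <;>
  · simp [dEn]
    field_simp
    try ring

lemma hessian_energy_s15 (lam μ : ℝ) (y : ℝ × ℝ) (hy : 0 < y.1) (a b : ℝ × ℝ) :
    hessian (fun y : ℝ × ℝ => (y.1 ^ 2 + y.2 ^ 2) * angW lam μ y) y a b =
      2 * angW lam μ y * ((a.1 + lam * a.2) * b.1 + (a.2 - lam * a.1) * b.2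
        - 2 * lam * ((-y.2 * a.1 + y.1 * a.2) / (y.1 ^ 2 + y.2 ^ 2)) *
          ((y.1 + lam * y.2) * b.1 + (y.2 - lam * y.1) * b.2)) := by
  have he : fderiv ℝ (fun y : ℝ × ℝ => (y.1 ^ 2 + y.2 ^ 2) * angW lam μ y)
      =ᶠ[nhds y] dEn lam μ := by
    filter_upwards [(isOpen_lt continuous_const continuous_fst).mem_nhds hy] with z hz
    exact (hasFDerivAt_energy_s15 lam μ z hz).fderiv
  have h1 : HasFDerivAt (fun y : ℝ × ℝ => y.1) (ContinuousLinearMap.fst ℝ ℝ ℝ) y := hasFDerivAt_fst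
  have h2 : HasFDerivAt (fun y : ℝ × ℝ => y.2) (ContinuousLinearMap.snd ℝ ℝ ℝ) y := hasFDerivAt_snd
  have h : HasFDerivAt (dEn lam μ) _ y :=
    ((hasFDerivAt_angW lam μ y hy).const_mul 2).smul
      (((h1.add (h2.const_mul lam)).smul_const (ContinuousLinearMap.fst ℝ ℝ ℝ)).add
        ((h2.sub (h1.const_mul lam)).smul_const (ContinuousLinearMap.snd ℝ ℝ ℝ)))
  unfold hessian
  rw [he.fderiv_eq, h.fderiv]
  simp
  ring

theorem quadratic_spray_case_one (lam μ ε₁ ε₂ : ℝ) (hμ : 0 < μ) :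
    let E : ℝ × ℝ → ℝ := fun y =>
      (y.1 ^ 2 + y.2 ^ 2) * (μ * Real.exp (-2 * lam * Real.arctan (y.2 / y.1)))
    let η : ℝ × ℝ → ℝ × ℝ := fun y =>
      (-(((ε₁ * y.1 + ε₂ * y.2) + lam * (-ε₂ * y.1 + ε₁ * y.2)) / (lam ^ 2 + 1))) •
        ((lam * y.1 - y.2, y.1 + lam * y.2) : ℝ × ℝ)
    ∀ y : ℝ × ℝ, 0 < y.1 → ∀ u : ℝ × ℝ,
      hessian E y (η y) u = hessian E y y (bracket ε₁ ε₂ u y) := by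
  intro E η y hy u
  have hr : y.1 ^ 2 + y.2 ^ 2 ≠ 0 := by positivity
  have hl : lam ^ 2 + 1 ≠ 0 := by positivity
  have hE : E = fun y : ℝ × ℝ => (y.1 ^ 2 + y.2 ^ 2) * angW lam μ y := rfl
  rw [hE, hessian_energy_s15 lam μ y hy, hessian_energy_s15 lam μ y hy]
  simp only [η, bracket, Prod.smul_mk, smul_eq_mul]
  congr 1
  field_simp
  ring
end

section
/- Let λ > 2, μ > 0, ε₁, ε₂ ∈ ℝ. On the open quadrant {(y¹,y²) ∈ ℝ² : y¹ > 0, y² > 0}, let E(y¹,y²) = ((y¹)² + (y²)²)·f(arctan(y²/y¹)) with f(t) = μ·(cos t)^{2−λ}·(sin t)^{λ}, let g_y be the Hessian bilinear form of E at y, and equip ℝ² with the Lie bracket [u,v] = (u¹v² − u²v¹)·(ε₁, ε₂). Then the quadratic map η(y) = −[ε₁(2−λ)y² + ε₂λy¹]/(λ² − 2λ) · (−λy¹, (2−λ)y²) satisfies g_y(η(y), u) = g_y(y, [u, y]) for every y in the quadrant and every u ∈ ℝ², i.e. the spray vector field of the conic Finsler metric F = √(2E) is quadratic. -/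
open Real Set

lemma energy_eq (lam μ a b : ℝ) (ha : 0 < a) (hb : 0 < b) :
    (a ^ 2 + b ^ 2) * (μ * Real.cos (Real.arctan (b / a)) ^ (2 - lam) *
          Real.sin (Real.arctan (b / a)) ^ lam) = μ * a ^ (2 - lam) * b ^ lam := by
  have hr : 0 < √(a ^ 2 + b ^ 2) := by positivity
  have hs : √(1 + (b / a) ^ 2) = √(a ^ 2 + b ^ 2) / a := by
    rw [show 1 + (b / a) ^ 2 = (a ^ 2 + b ^ 2) / a ^ 2 by field_simp,
      Real.sqrt_div (by positivity), Real.sqrt_sq ha.le]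
  have hr2 : a ^ 2 + b ^ 2 = √(a ^ 2 + b ^ 2) ^ 2 := (Real.sq_sqrt (by positivity)).symm
  have hc : Real.cos (Real.arctan (b / a)) = a / √(a ^ 2 + b ^ 2) := by
    rw [Real.cos_arctan, hs]; field_simp
  have hsn : Real.sin (Real.arctan (b / a)) = b / √(a ^ 2 + b ^ 2) := by
    rw [Real.sin_arctan, hs]; field_simp
  rw [hc, hsn, hr2, Real.sqrt_sq hr.le]
  set r := √(a ^ 2 + b ^ 2)
  rw [Real.div_rpow ha.le hr.le, Real.div_rpow hb.le hr.le]
  have h2 : r ^ (2 - lam) * r ^ lam = r ^ 2 := by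
    rw [← Real.rpow_add hr]; norm_num
  have h3 : 0 < r ^ (2 - lam) := Real.rpow_pos_of_pos hr _
  have h4 : 0 < r ^ lam := Real.rpow_pos_of_pos hr _
  rw [← h2]
  field_simp

lemma mono_fderiv (c p q : ℝ) (y : ℝ × ℝ) (h1 : 0 < y.1) (h2 : 0 < y.2) :
    HasFDerivAt (fun z : ℝ × ℝ => c * z.1 ^ p * z.2 ^ q)
      ((c * p * y.1 ^ (p - 1) * y.2 ^ q) • ContinuousLinearMap.fst ℝ ℝ ℝ +
        (c * q * y.1 ^ p * y.2 ^ (q - 1)) • ContinuousLinearMap.snd ℝ ℝ ℝ) y := by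
  have e1 := (hasFDerivAt_fst (𝕜 := ℝ) (p := y)).rpow_const (p := p) (Or.inl h1.ne')
  have e2 := (hasFDerivAt_snd (𝕜 := ℝ) (p := y)).rpow_const (p := q) (Or.inl h2.ne')
  refine ((e1.const_mul c).mul e2).congr_fderiv ?_
  ext <;> simp <;> ring

lemma hessian_formula (E : ℝ × ℝ → ℝ) (lam μ : ℝ)
    (hE : ∀ z : ℝ × ℝ, 0 < z.1 → 0 < z.2 → E z = μ * z.1 ^ (2 - lam) * z.2 ^ lam)
    (y u v : ℝ × ℝ) (h1 : 0 < y.1) (h2 : 0 < y.2) :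
    hessian E y u v = μ * y.1 ^ (-lam) * y.2 ^ (lam - 2) *
      ((2 - lam) * (1 - lam) * y.2 ^ 2 * u.1 * v.1
        + (2 - lam) * lam * y.1 * y.2 * (u.1 * v.2 + u.2 * v.1)
        + lam * (lam - 1) * y.1 ^ 2 * u.2 * v.2) := by
  have hev : ∀ y : ℝ × ℝ, 0 < y.1 → 0 < y.2 → ∀ᶠ z : ℝ × ℝ in nhds y, 0 < z.1 ∧ 0 < z.2 :=
    fun y h1 h2 => (continuousAt_fst.eventually (lt_mem_nhds h1)).and
      (continuousAt_snd.eventually (lt_mem_nhds h2))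
  have hd : fderiv ℝ E =ᶠ[nhds y] fun z =>
      ((μ * (2 - lam)) * z.1 ^ (2 - lam - 1) * z.2 ^ lam) • ContinuousLinearMap.fst ℝ ℝ ℝ +
        ((μ * lam) * z.1 ^ (2 - lam) * z.2 ^ (lam - 1)) • ContinuousLinearMap.snd ℝ ℝ ℝ := by
    filter_upwards [hev y h1 h2] with z hz
    have : E =ᶠ[nhds z] fun z => μ * z.1 ^ (2 - lam) * z.2 ^ lam := by
      filter_upwards [hev z hz.1 hz.2] with w hw using hE w hw.1 hw.2
    rw [this.fderiv_eq]
    exact (mono_fderiv μ (2 - lam) lam z hz.1 hz.2).fderiv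
  have k1 := mono_fderiv (μ * (2 - lam)) (2 - lam - 1) lam y h1 h2
  have k2 := mono_fderiv (μ * lam) (2 - lam) (lam - 1) y h1 h2
  have k := (k1.smul_const (ContinuousLinearMap.fst ℝ ℝ ℝ)).add
    (k2.smul_const (ContinuousLinearMap.snd ℝ ℝ ℝ))
  have a1 : y.1 ^ (2 - lam - 1) = y.1 ^ (-lam) * y.1 := by
    rw [← Real.rpow_add_one h1.ne']; congr 1; ring
  have a2 : y.1 ^ (2 - lam) = y.1 ^ (-lam) * y.1 ^ 2 := by
    rw [← Real.rpow_add_natCast h1.ne']; congr 1; push_cast; ring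
  have a0 : y.1 ^ (2 - lam - 1 - 1) = y.1 ^ (-lam) := by congr 1; ring
  have b1 : y.2 ^ (lam - 1) = y.2 ^ (lam - 2) * y.2 := by
    rw [← Real.rpow_add_one h2.ne']; congr 1; ring
  have b2 : y.2 ^ lam = y.2 ^ (lam - 2) * y.2 ^ 2 := by
    rw [← Real.rpow_add_natCast h2.ne']; congr 1; push_cast; ring
  have b0 : y.2 ^ (lam - 1 - 1) = y.2 ^ (lam - 2) := by congr 1; ring
  unfold hessian
  rw [hd.fderiv_eq]
  erw [k.fderiv]
  simp only [_root_.add_apply, ContinuousLinearMap.smulRight_apply,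
    _root_.smul_apply, ContinuousLinearMap.coe_fst', ContinuousLinearMap.coe_snd',
    smul_eq_mul, a0, b0, a1, b1, a2, b2]
  ring

theorem quadratic_spray_case_two (lam μ ε₁ ε₂ : ℝ) (hlam : 2 < lam) (hμ : 0 < μ) :
    let E : ℝ × ℝ → ℝ := fun y =>
      (y.1 ^ 2 + y.2 ^ 2) *
        (μ * Real.cos (Real.arctan (y.2 / y.1)) ^ (2 - lam) *
          Real.sin (Real.arctan (y.2 / y.1)) ^ lam)
    let η : ℝ × ℝ → ℝ × ℝ := fun y =>
      (-((ε₁ * (2 - lam) * y.2 + ε₂ * lam * y.1) / (lam ^ 2 - 2 * lam))) •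
        ((-lam * y.1, (2 - lam) * y.2) : ℝ × ℝ)
    ∀ y : ℝ × ℝ, 0 < y.1 → 0 < y.2 → ∀ u : ℝ × ℝ,
      hessian E y (η y) u = hessian E y y (bracket ε₁ ε₂ u y) := by
  intro E η y h1 h2 u
  have hE : ∀ z : ℝ × ℝ, 0 < z.1 → 0 < z.2 → E z = μ * z.1 ^ (2 - lam) * z.2 ^ lam :=
    fun z hz1 hz2 => energy_eq lam μ z.1 z.2 hz1 hz2
  rw [hessian_formula E lam μ hE _ _ _ h1 h2, hessian_formula E lam μ hE _ _ _ h1 h2]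
  congr 1
  have hl : lam ^ 2 - 2 * lam ≠ 0 := by nlinarith
  simp only [η, bracket, Prod.smul_fst, Prod.smul_snd, smul_eq_mul]
  set c := (ε₁ * (2 - lam) * y.2 + ε₂ * lam * y.1) / (lam ^ 2 - 2 * lam) with hc
  have hc' : c * (lam ^ 2 - 2 * lam) = ε₁ * (2 - lam) * y.2 + ε₂ * lam * y.1 := by
    rw [hc]; exact div_mul_cancel₀ _ hl
  linear_combination (y.1 * y.2 ^ 2 * u.1 - y.1 ^ 2 * y.2 * u.2) * hc'
end

section
/- Let λ > 0, μ > 0, ε₁, ε₂ ∈ ℝ. On the cone {(y¹,y²) ∈ ℝ² : y¹ > 0}, let E(y¹,y²) = ((y¹)² + (y²)²)·f(arctan(y²/y¹)) with f(t) = μ·(cos t)²·exp(−2λ·tan t), let g_y be the Hessian bilinear form of E at y, and equip ℝ² with the Lie bracket [u,v] = (u¹v² − u²v¹)·(ε₁, ε₂). Then the quadratic map η(y) = −[(ε₁ − λε₂)y¹ + λε₁y²]/λ² · (λy¹, y¹ + λy²) satisfies g_y(η(y), u) = g_y(y, [u, y]) for every y in the cone and every u ∈ ℝ², i.e. the spray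 vector field of the conic Finsler metric F = √(2E) is quadratic. -/
open Real Set

lemma aux_exp (lam : ℝ) (p : ℝ × ℝ) (hp : 0 < p.1) :
    HasFDerivAt (fun q : ℝ × ℝ => Real.exp (-2 * lam * (q.2 / q.1)))
      (Real.exp (-2 * lam * (p.2 / p.1)) •
        ((2 * lam * p.2 / p.1 ^ 2) • ContinuousLinearMap.fst ℝ ℝ ℝ
          + (-2 * lam / p.1) • ContinuousLinearMap.snd ℝ ℝ ℝ)) p := by
  have h1 : HasFDerivAt (fun q : ℝ × ℝ => q.1) (ContinuousLinearMap.fst ℝ ℝ ℝ) p := hasFDerivAt_fst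
  have h2 : HasFDerivAt (fun q : ℝ × ℝ => q.2) (ContinuousLinearMap.snd ℝ ℝ ℝ) p := hasFDerivAt_snd
  have hi := (hasDerivAt_inv hp.ne').comp_hasFDerivAt p h1
  have h := ((h2.mul hi).const_mul (-2 * lam)).exp
  refine h.congr_fderiv ?_
  have := hp.ne'
  ext <;> simp [div_eq_mul_inv] <;> ring

theorem quadratic_spray_case_three (lam μ ε₁ ε₂ : ℝ) (hlam : 0 < lam) (hμ : 0 < μ) :
    let E : ℝ × ℝ → ℝ := fun y =>
      (y.1 ^ 2 + y.2 ^ 2) *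
        (μ * Real.cos (Real.arctan (y.2 / y.1)) ^ 2 *
          Real.exp (-2 * lam * Real.tan (Real.arctan (y.2 / y.1))))
    let η : ℝ × ℝ → ℝ × ℝ := fun y =>
      (-(((ε₁ - lam * ε₂) * y.1 + lam * ε₁ * y.2) / lam ^ 2)) •
        ((lam * y.1, y.1 + lam * y.2) : ℝ × ℝ)
    ∀ y : ℝ × ℝ, 0 < y.1 → ∀ u : ℝ × ℝ,
      hessian E y (η y) u = hessian E y y (bracket ε₁ ε₂ u y) := by
  intro E η y hy u
  have hopen : IsOpen {p : ℝ × ℝ | 0 < p.1} := isOpen_lt continuous_const continuous_fst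
  have hE : ∀ p : ℝ × ℝ, 0 < p.1 →
      E p = μ * p.1 ^ 2 * Real.exp (-2 * lam * (p.2 / p.1)) := by
    intro p hp
    have h0 : p.1 ^ 2 + p.2 ^ 2 ≠ 0 := by positivity
    have h1 := hp.ne'
    simp only [E, Real.tan_arctan, Real.cos_sq_arctan]
    have : 1 / (1 + (p.2 / p.1) ^ 2) = p.1 ^ 2 / (p.1 ^ 2 + p.2 ^ 2) := by
      have : 1 + (p.2 / p.1) ^ 2 ≠ 0 := by positivity
      field_simp
    rw [this]
    field_simp
  have hfst : ∀ p : ℝ × ℝ, HasFDerivAt (fun q : ℝ × ℝ => q.1) (ContinuousLinearMap.fst ℝ ℝ ℝ) p :=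
    fun p => hasFDerivAt_fst
  have hsnd : ∀ p : ℝ × ℝ, HasFDerivAt (fun q : ℝ × ℝ => q.2) (ContinuousLinearMap.snd ℝ ℝ ℝ) p :=
    fun p => hasFDerivAt_snd
  let G : ℝ × ℝ → (ℝ × ℝ →L[ℝ] ℝ) := fun p =>
    (Real.exp (-2 * lam * (p.2 / p.1)) * (2 * μ * (p.1 + lam * p.2))) •
        ContinuousLinearMap.fst ℝ ℝ ℝ
      + (Real.exp (-2 * lam * (p.2 / p.1)) * (-2 * μ * lam * p.1)) •
        ContinuousLinearMap.snd ℝ ℝ ℝ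
  have hG : fderiv ℝ E =ᶠ[nhds y] G := by
    filter_upwards [hopen.mem_nhds hy] with p hp
    have hp' : 0 < p.1 := hp
    have h := (((hfst p).pow 2).const_mul μ).mul (aux_exp lam p hp')
    have h2 : HasFDerivAt E _ p := h.congr_of_eventuallyEq (by
      filter_upwards [hopen.mem_nhds hp] with q hq
      simpa using hE q hq)
    rw [h2.fderiv]
    have := hp'.ne'
    ext <;> simp [G] <;> field_simp <;> ring
  have hG' := (((aux_exp lam y hy).mul
      (((hfst y).add ((hsnd y).const_mul lam)).const_mul (2 * μ))).smul_const
        (ContinuousLinearMap.fst ℝ ℝ ℝ)).add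
    (((aux_exp lam y hy).mul ((hfst y).const_mul (-2 * μ * lam))).smul_const
        (ContinuousLinearMap.snd ℝ ℝ ℝ))
  have hF : HasFDerivAt G _ y := hG'
  unfold hessian
  rw [hG.fderiv_eq, hF.fderiv]
  have h1 := hy.ne'
  have h2 := hlam.ne'
  simp [η, bracket]
  generalize Real.exp _ = w
  field_simp
  ring
end

section
/- Let I ⊆ (−π/2, π/2) be a nonempty open interval and f : I → ℝ a smooth function with f > 0 on I. If 2f(t)·sin t + f'(t)·cos t = 0 for all t ∈ I, then D(t) = 2f(t)f''(t) − f'(t)² + 4f(t)² = 0 for all t ∈ I. In particular, the conic Finsler norm F = r√(2f(t)) is not strongly convex on any open subinterval where its spray vector field (for the Lie bracket [e₁,e₂] = e₂) vanishes identically. -/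
open Real Set

theorem vanishing_spray_kills_convexity
    (I : Set ℝ) (hIopen : IsOpen I) (hInonempty : I.Nonempty)
    (hIconn : I.OrdConnected) (hIsub : I ⊆ Ioo (-(π / 2)) (π / 2))
    (f : ℝ → ℝ) (hf : ContDiffOn ℝ (⊤ : ℕ∞) f I) (hfpos : ∀ t ∈ I, 0 < f t)
    (hspray : ∀ t ∈ I, 2 * f t * Real.sin t + deriv f t * Real.cos t = 0) :
    ∀ t ∈ I, Dfun f t = 0 := by
  intro t ht
  have hc : 0 < Real.cos t := Real.cos_pos_of_mem_Ioo (hIsub ht)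
  have hnhds : I ∈ nhds t := hIopen.mem_nhds ht
  have h1 : HasDerivAt f (deriv f t) t :=
    ((hf.contDiffAt hnhds).differentiableAt (by simp)).hasDerivAt
  have hd : ContDiffOn ℝ 1 (deriv f) I :=
    ((contDiffOn_succ_iff_deriv_of_isOpen (n := 1) hIopen).1
      (hf.of_le (show (((1 + 1 : ℕ∞)) : WithTop ℕ∞) ≤ ((⊤ : ℕ∞) : WithTop ℕ∞) from WithTop.coe_le_coe.2 le_top))).2.2
  have h2 : HasDerivAt (deriv f) (deriv (deriv f) t) t :=
    ((hd.contDiffAt hnhds).differentiableAt (by simp)).hasDerivAt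
  have h3 := ((h1.const_mul 2).mul (Real.hasDerivAt_sin t)).add
    (h2.mul (Real.hasDerivAt_cos t))
  have h4 := h3.congr_of_eventuallyEq (f₁ := fun _ => (0 : ℝ))
    (Filter.eventually_of_mem hnhds fun x hx => (hspray x hx).symm)
  have h5 := h4.unique (hasDerivAt_const t (0 : ℝ))
  have h0 := hspray t ht
  have key : Real.cos t ^ 2 * Dfun f t = 0 := by
    unfold Dfun
    linear_combination (2 * f t * Real.cos t) * h5 - (deriv f t * Real.cos t) * h0
  exact (mul_eq_zero.1 key).resolve_left (by positivity)
end
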